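/- Every graph with maximum degree 4 on n vertices admits a 1-bend RAC drawing of O(n²) area. -/

import Mathlib

open scoped Classical

noncomputable section

/-- A point of the Euclidean plane. -/
abbrev Pt : Type := ℝ × ℝ

/-- The segments with endpoints `a, b` and `c, d` are orthogonal:
their direction vectors have zero inner product. -/
def SegOrth (a b c d : Pt) : Prop :=
  (b.1 - a.1) * (d.1 - c.1) + (b.2 - a.2) * (d.2 - c.2) = 0

/-- The degree of a vertex in a simple graph. -/
def vdeg {V : Type*} (G : SimpleGraph V) (v : V) : ℕ := (G.neighborSet v).ncard

/-- `M` is a matching in `G`: a set of edges of `G` that are pairwise non-adjacent. -/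
def IsMatchingOn {V : Type*} (G : SimpleGraph V) (M : Set (Sym2 V)) : Prop :=
  M ⊆ G.edgeSet ∧ ∀ e ∈ M, ∀ f ∈ M, e ≠ f → ∀ v : V, v ∈ e → v ∉ f

/-- `G` is `k`-edge-colorable: its edge set is partitioned into `k` matchings. -/
def EdgeColorable {V : Type*} (G : SimpleGraph V) (k : ℕ) : Prop :=
  ∃ M : Fin k → Set (Sym2 V),
    (∀ i, IsMatchingOn G (M i)) ∧
    (∀ i j, i ≠ j → Disjoint (M i) (M j)) ∧
    (⋃ i, M i) = G.edgeSet

/-- `p` is a straight-line RAC drawing of `G`: vertices are at pairwise distinct points,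
each edge is the closed segment between its endpoints, no edge passes through another
vertex, edges sharing an endpoint meet only there, and any two edges with no common
endpoint that intersect do so orthogonally. -/
structure IsRACDrawing {V : Type*} (G : SimpleGraph V) (p : V → Pt) : Prop where
  inj : Function.Injective p
  vertex_off : ∀ u v w : V, G.Adj u v → w ≠ u → w ≠ v →
    p w ∉ segment ℝ (p u) (p v)
  shared : ∀ u v w : V, G.Adj u v → G.Adj u w → v ≠ w →
    segment ℝ (p u) (p v) ∩ segment ℝ (p u) (p w) ⊆ {p u}
  rac : ∀ u v u' v' : V, G.Adj u v → G.Adj u' v' →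
    u ≠ u' → u ≠ v' → v ≠ u' → v ≠ v' →
    (segment ℝ (p u) (p v) ∩ segment ℝ (p u') (p v')).Nonempty →
    SegOrth (p u) (p v) (p u') (p v')

/-- All points of `P` are integer grid points lying in an axis-aligned square
of side length `side`. -/
def InGridSquare (side : ℝ) (P : Set Pt) : Prop :=
  (∀ q ∈ P, ∃ a b : ℤ, q = ((a : ℝ), (b : ℝ))) ∧
  ∃ x0 y0 : ℝ, ∀ q ∈ P, x0 ≤ q.1 ∧ q.1 ≤ x0 + side ∧ y0 ≤ q.2 ∧ q.2 ≤ y0 + side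

/-- The list of consecutive segments (as pairs of endpoints) of a polyline given
by its list of points. -/
def polySegs (l : List Pt) : List (Pt × Pt) := l.zip l.tail

/-- The set of plane points covered by a polyline given by its list of points. -/
def polySet (l : List Pt) : Set Pt := ⋃ s ∈ polySegs l, segment ℝ s.1 s.2

/-- `p, poly` is a `k`-bend RAC drawing of `G`: each edge `e` is drawn as the polyline
through the list of points `poly e` (at most `k + 1` segments, i.e. at most `k + 2`
points) joining the two endpoints of `e`; no edge passes through another vertex; edges
sharing an endpoint meet only at that endpoint; any two distinct edges intersect in
finitely many points; and wherever segments of two distinct edges meet (other than at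
the point of a common endvertex) the two segments are orthogonal. -/
structure IsBendRACDrawing {V : Type*} (k : ℕ) (G : SimpleGraph V)
    (p : V → Pt) (poly : Sym2 V → List Pt) : Prop where
  inj : Function.Injective p
  ends : ∀ e ∈ G.edgeSet, ∃ u v : V, e = s(u, v) ∧
    (poly e).head? = some (p u) ∧ (poly e).getLast? = some (p v)
  nsegs : ∀ e ∈ G.edgeSet, 2 ≤ (poly e).length ∧ (poly e).length ≤ k + 2
  vertex_off : ∀ e ∈ G.edgeSet, ∀ w : V, w ∉ e → p w ∉ polySet (poly e)
  shared : ∀ e ∈ G.edgeSet, ∀ e' ∈ G.edgeSet, e ≠ e' → ∀ w : V, w ∈ e → w ∈ e' →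
    polySet (poly e) ∩ polySet (poly e') ⊆ {p w}
  fin_inter : ∀ e ∈ G.edgeSet, ∀ e' ∈ G.edgeSet, e ≠ e' →
    (polySet (poly e) ∩ polySet (poly e')).Finite
  rac : ∀ e ∈ G.edgeSet, ∀ e' ∈ G.edgeSet, e ≠ e' →
    ∀ s ∈ polySegs (poly e), ∀ s' ∈ polySegs (poly e'),
    ∀ x : Pt, x ∈ segment ℝ s.1 s.2 → x ∈ segment ℝ s'.1 s'.2 →
    (∀ w : V, w ∈ e → w ∈ e' → x ≠ p w) →
    SegOrth s.1 s.2 s'.1 s'.2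

/-- All vertex points and bend points of a polyline drawing. -/
def drawingPoints {V : Type*} (G : SimpleGraph V) (p : V → Pt)
    (poly : Sym2 V → List Pt) : Set Pt :=
  Set.range p ∪ {q | ∃ e ∈ G.edgeSet, q ∈ poly e}

/-- `F` is (the edge set of) a 2-factor of `G`: a spanning subgraph in which every
vertex has degree exactly 2. -/
def Is2Factor {V : Type*} (G : SimpleGraph V) (F : Set (Sym2 V)) : Prop :=
  F ⊆ G.edgeSet ∧ ∀ v : V, {e ∈ F | v ∈ e}.ncard = 2

/-- The connected components of the (2-regular) spanning subgraph with edge set `F`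
that are odd cycles, i.e. have an odd number of vertices. -/
def oddComps {V : Type*} (F : Set (Sym2 V)) :
    Set ((SimpleGraph.fromEdgeSet F).ConnectedComponent) :=
  {C | Odd C.supp.ncard}

/-- `G` has oddness `k`: the minimum over all 2-factors of the number of odd-cycle
components equals `k` (in particular a 2-factor exists). -/
def HasOddness {V : Type*} (G : SimpleGraph V) (k : ℕ) : Prop :=
  (∃ F, Is2Factor G F ∧ (oddComps F).ncard = k) ∧
  (∀ F, Is2Factor G F → k ≤ (oddComps F).ncard)

/-- `G` has no cut-edge. -/
def Bridgeless {V : Type*} (G : SimpleGraph V) : Prop := ∀ e, ¬ G.IsBridge e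


theorem petersen_orient {W E : Type} [Fintype W] [Fintype E] (e1 e2 : E → W)
    (hne : ∀ e, e1 e ≠ e2 e)
    (hdeg : ∀ w, (Finset.univ.filter (fun e => e1 e = w ∨ e2 e = w)).card = 4) :
    ∃ t : E → W, ∃ h : E → W, (∀ e, (t e = e1 e ∧ h e = e2 e) ∨ (t e = e2 e ∧ h e = e1 e)) ∧
      (∀ w, (Finset.univ.filter (fun e => t e = w)).card = 2) ∧
      (∀ w, (Finset.univ.filter (fun e => h e = w)).card = 2) := by
  -- counting
  have two : ∀ e, (Finset.univ.filter (fun w => e1 e = w ∨ e2 e = w)).card = 2 := by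
    intro e
    have : Finset.univ.filter (fun w => e1 e = w ∨ e2 e = w) = {e1 e, e2 e} := by
      ext w; simp [eq_comm]
    rw [this, Finset.card_pair (hne e)]
  have hall : ∃ f : E → W × Fin 2, Function.Injective f ∧
      ∀ e, f e ∈ (({e1 e, e2 e} : Finset W) ×ˢ (Finset.univ : Finset (Fin 2))) := by
    rw [← Finset.all_card_le_biUnion_card_iff_exists_injective]
    intro S
    have : S.biUnion (fun e => (({e1 e, e2 e} : Finset W) ×ˢ (Finset.univ : Finset (Fin 2))))
        = (S.biUnion (fun e => ({e1 e, e2 e} : Finset W))) ×ˢ (Finset.univ : Finset (Fin 2)) := by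
      ext ⟨a, b⟩; simp
    rw [this, Finset.card_product]
    set N := S.biUnion (fun e => ({e1 e, e2 e} : Finset W)) with hN
    have key := Finset.card_mul_le_card_mul (s := S) (t := N)
      (fun e w => e1 e = w ∨ e2 e = w) (m := 2) (n := 4) ?_ ?_
    · simp; omega
    · intro e he
      rw [← two e]
      apply Finset.card_le_card
      intro w hw
      simp only [Finset.mem_filter, Finset.mem_univ, true_and] at hw
      simp only [Finset.bipartiteAbove, Finset.mem_filter, hN, Finset.mem_biUnion]
      refine ⟨⟨e, he, ?_⟩, hw⟩
      rcases hw with h | h <;> simp [h]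
    · intro w _
      rw [← hdeg w]
      apply Finset.card_le_card
      intro e he
      simp only [Finset.bipartiteBelow, Finset.mem_filter] at he
      simp [he.2]
  obtain ⟨f, finj, hf⟩ := hall
  have hf' : ∀ e, (f e).1 = e1 e ∨ (f e).1 = e2 e := by
    intro e; have := hf e; simpa using this
  have cardE : Fintype.card E = 2 * Fintype.card W := by
    have key := Finset.card_mul_eq_card_mul (s := (Finset.univ : Finset E)) (t := (Finset.univ : Finset W))
      (fun e w => e1 e = w ∨ e2 e = w) (m := 2) (n := 4)
      (fun e _ => two e) (fun w _ => hdeg w)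
    simp at key; omega
  have fbij : Function.Bijective f := by
    rw [Fintype.bijective_iff_injective_and_card]
    refine ⟨finj, ?_⟩
    simp [cardE, mul_comm]
  have tcard : ∀ w, (Finset.univ.filter (fun e => (f e).1 = w)).card = 2 := by
    intro w
    have : (Finset.univ.filter (fun e => (f e).1 = w)).map ⟨f, finj⟩ =
        ({w} : Finset W) ×ˢ (Finset.univ : Finset (Fin 2)) := by
      ext ⟨a, b⟩
      simp only [Finset.mem_map, Finset.mem_filter, Finset.mem_univ, true_and,
        Function.Embedding.coeFn_mk, Finset.mem_product, Finset.mem_singleton, and_true]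
      constructor
      · rintro ⟨e, h1, h2⟩; rw [h2] at h1; exact h1
      · rintro rfl
        obtain ⟨e, he⟩ := fbij.2 (a, b)
        exact ⟨e, by rw [he], he⟩
    rw [← Finset.card_map ⟨f, finj⟩, this]; simp
  refine ⟨fun e => (f e).1, fun e => if (f e).1 = e1 e then e2 e else e1 e, ?_, tcard, ?_⟩
  · intro e
    rcases hf' e with h | h
    · left; simp [h]
    · right; simp [h, (hne e).symm]
  · intro w
    have h4 := hdeg w
    have hun : Finset.univ.filter (fun e => e1 e = w ∨ e2 e = w) =
       (Finset.univ.filter (fun e => (f e).1 = w)) ∪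
       (Finset.univ.filter (fun e => (if (f e).1 = e1 e then e2 e else e1 e) = w)) := by
      ext e
      simp only [Finset.mem_filter, Finset.mem_univ, true_and, Finset.mem_union]
      rcases hf' e with h | h
      · simp [h]
      · simp [h, (hne e).symm]; tauto
    rw [hun, Finset.card_union_of_disjoint, tcard w] at h4
    · have h5 : 2 + _ = 2 + 2 := h4
      have h6 := Nat.add_left_cancel h5
      convert h6 using 2
    · rw [Finset.disjoint_left]
      intro e
      simp only [Finset.mem_filter, Finset.mem_univ, true_and]
      rcases hf' e with h | h
      · simp only [h, if_true]; intro h1 h2; exact hne e (h1.trans h2.symm)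
      · simp only [h, (hne e).symm, if_false]; intro h1 h2; exact hne e (h2.trans h1.symm)

theorem petersen_perms {W E : Type} [Fintype W] [Fintype E] (t h : E → W)
    (ht : ∀ w, (Finset.univ.filter (fun e => t e = w)).card = 2)
    (hh : ∀ w, (Finset.univ.filter (fun e => h e = w)).card = 2) :
    ∃ σ τ : Equiv.Perm W, ∀ e, h e = σ (t e) ∨ h e = τ (t e) := by
  have hall : ∃ f : W → W, Function.Injective f ∧
      ∀ w, f w ∈ (Finset.univ.filter (fun e => t e = w)).image h := by
    rw [← Finset.all_card_le_biUnion_card_iff_exists_injective]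
    intro S
    set N := S.biUnion (fun w => (Finset.univ.filter (fun e => t e = w)).image h) with hN
    have h1 : (Finset.univ.filter (fun e => t e ∈ S)).card = 2 * S.card := by
      rw [Finset.card_eq_sum_card_fiberwise (f := t) (t := S) (fun e he => by simpa using he)]
      rw [Finset.sum_congr rfl (g := fun _ => 2), Finset.sum_const, smul_eq_mul, mul_comm]
      intro w hw
      rw [← ht w]; congr 1; ext e; simp only [Finset.mem_filter, Finset.mem_univ, true_and]
      constructor
      · exact fun h => h.2
      · rintro rfl; exact ⟨hw, rfl⟩
    have h2 : (Finset.univ.filter (fun e => h e ∈ N)).card = 2 * N.card := by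
      rw [Finset.card_eq_sum_card_fiberwise (f := h) (t := N) (fun e he => by simpa using he)]
      rw [Finset.sum_congr rfl (g := fun _ => 2), Finset.sum_const, smul_eq_mul, mul_comm]
      intro w hw
      rw [← hh w]; congr 1; ext e; simp only [Finset.mem_filter, Finset.mem_univ, true_and]
      constructor
      · exact fun h => h.2
      · rintro rfl; exact ⟨hw, rfl⟩
    have h3 : (Finset.univ.filter (fun e => t e ∈ S)).card ≤
        (Finset.univ.filter (fun e => h e ∈ N)).card := by
      apply Finset.card_le_card
      intro e he
      simp only [Finset.mem_filter, Finset.mem_univ, true_and] at he ⊢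
      rw [hN, Finset.mem_biUnion]
      exact ⟨t e, he, Finset.mem_image.2 ⟨e, by simp, rfl⟩⟩
    omega
  obtain ⟨f, finj, hf⟩ := hall
  have hf' : ∀ w, ∃ e, t e = w ∧ h e = f w := by
    intro w; have := hf w; simpa using this
  choose a ha1 ha2 using hf'
  have hb : ∀ w, ∃ b, b ≠ a w ∧ t b = w ∧ ∀ e, t e = w → e = a w ∨ e = b := by
    intro w
    obtain ⟨p, q, hpq, hs⟩ := Finset.card_eq_two.1 (ht w)
    have hm : ∀ e, t e = w ↔ e = p ∨ e = q := by
      intro e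
      have : e ∈ Finset.univ.filter (fun e => t e = w) ↔ e ∈ ({p, q} : Finset E) := by rw [hs]
      simpa using this
    rcases (hm (a w)).1 (ha1 w) with h | h
    · exact ⟨q, by rw [h]; exact hpq.symm, (hm q).2 (Or.inr rfl), fun e he => by rw [h]; exact (hm e).1 he⟩
    · exact ⟨p, by rw [h]; exact hpq, (hm p).2 (Or.inl rfl), fun e he => by rw [h]; exact ((hm e).1 he).symm⟩
  choose b hb1 hb2 hb3 using hb
  have fsurj : Function.Surjective f := Finite.injective_iff_surjective.1 finj
  have ginj : Function.Injective (fun w => h (b w)) := by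
    intro v w hvw
    by_contra hne
    obtain ⟨u, hu⟩ := fsurj (h (b v))
    have h3 : ({a u, b v, b w} : Finset E).card ≤ 2 := by
      rw [← hh (h (b v))]
      apply Finset.card_le_card
      intro e he
      simp only [Finset.mem_insert, Finset.mem_singleton] at he
      simp only [Finset.mem_filter, Finset.mem_univ, true_and]
      rcases he with rfl | rfl | rfl
      · rw [ha2, hu]
      · rfl
      · exact hvw.symm
    rw [Finset.card_eq_three.2] at h3
    · omega
    · have key : ∀ z, a u ≠ b z := by
        intro z hz
        have : u = z := by rw [← ha1 u, hz, hb2]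
        subst this; exact hb1 u hz.symm
      refine ⟨_, _, _, key v, key w, ?_, rfl⟩
      intro hz
      apply hne
      rw [← hb2 v, hz, hb2]
  refine ⟨Equiv.ofBijective f (Finite.injective_iff_bijective.1 finj),
    Equiv.ofBijective _ (Finite.injective_iff_bijective.1 ginj), ?_⟩
  intro e
  rcases hb3 (t e) e rfl with h1 | h1
  · left; simp only [Equiv.ofBijective_apply]; rw [← ha2, ← h1]
  · right; simp only [Equiv.ofBijective_apply]; rw [← h1]

theorem graph_perms (V : Type) [Fintype V] (G : SimpleGraph V)
    (hG : ∀ v : V, (G.neighborSet v).ncard ≤ 4) :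
    ∃ σ τ : Equiv.Perm (V × Bool), ∀ u v, G.Adj u v →
      ((v, true) = σ (u, true) ∨ (u, true) = σ (v, true) ∨
       (v, true) = τ (u, true) ∨ (u, true) = τ (v, true)) := by
  have hdeg : ∀ v, G.degree v ≤ 4 := by
    intro v
    have h1 := hG v
    rwa [← Nat.card_coe_set_eq, Nat.card_eq_fintype_card, SimpleGraph.card_neighborSet_eq_degree] at h1
  have hout : ∀ e : G.edgeSet, ∃ p : V × V, s(p.1, p.2) = e.1 := by
    rintro ⟨e, he⟩
    induction e with
    | _ a b => exact ⟨(a, b), rfl⟩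
  choose q hq using hout
  have hqadj : ∀ e, G.Adj (q e).1 (q e).2 := by
    intro e
    have := e.2
    rw [← hq e] at this
    exact this
  let E := (G.edgeSet × Bool) ⊕ (Σ v : V, Fin (4 - G.degree v))
  let e1 : E → V × Bool := fun e => match e with
    | Sum.inl (e, i) => ((q e).1, i)
    | Sum.inr ⟨v, _⟩ => (v, true)
  let e2 : E → V × Bool := fun e => match e with
    | Sum.inl (e, i) => ((q e).2, i)
    | Sum.inr ⟨v, _⟩ => (v, false)
  obtain ⟨t, h, hth, ht, hh⟩ := petersen_orient e1 e2 (by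
    rintro (⟨e, i⟩ | ⟨v, j⟩)
    · intro h
      exact (hqadj e).ne (congrArg Prod.fst h)
    · intro h
      exact absurd (congrArg Prod.snd h) (by simp [e1, e2])) (by
    rintro ⟨w, i⟩
    have h1 : (Finset.univ.filter (fun e : G.edgeSet => w ∈ e.1)).card = G.degree w := by
      rw [← SimpleGraph.card_incidenceFinset_eq_degree, ← Finset.card_map (Function.Embedding.subtype _)]
      congr 1
      ext e
      simp [SimpleGraph.incidenceSet]
      tauto
    have h2 : Finset.univ.filter (fun e => e1 e = (w, i) ∨ e2 e = (w, i)) =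
      ((Finset.univ.filter (fun e : G.edgeSet => w ∈ e.1)).map
        ⟨fun e => (Sum.inl (e, i) : E), fun a b hab => by simpa using hab⟩) ∪
      ((Finset.univ : Finset (Fin (4 - G.degree w))).map
        ⟨fun j => (Sum.inr ⟨w, j⟩ : E), fun a b hab => by simpa using hab⟩) := by
      ext e
      rcases e with ⟨e, j⟩ | ⟨v, j⟩
      · have hw : w ∈ e.1 ↔ w = (q e).1 ∨ w = (q e).2 := by
          rw [← hq e, Sym2.mem_iff]
        simp only [e1, e2, Finset.mem_filter, Finset.mem_univ, true_and, Finset.mem_union,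
          Finset.mem_map, Function.Embedding.coeFn_mk, Prod.mk.injEq]
        constructor
        · rintro (⟨h1, h2⟩ | ⟨h1, h2⟩)
          · exact Or.inl ⟨e, hw.2 (Or.inl h1.symm), by rw [h2]; rfl⟩
          · exact Or.inl ⟨e, hw.2 (Or.inr h1.symm), by rw [h2]; rfl⟩
        · rintro (⟨e', h1, h2⟩ | ⟨k, h1, h2⟩)
          · have h3 := Sum.inl.inj h2
            have h4 : e' = e := congrArg Prod.fst h3
            have h5 : i = j := congrArg Prod.snd h3
            subst h4
            rcases hw.1 h1 with h | h
            · exact Or.inl ⟨h.symm, h5.symm⟩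
            · exact Or.inr ⟨h.symm, h5.symm⟩
      · simp only [e1, e2, Finset.mem_filter, Finset.mem_univ, true_and, Finset.mem_union,
          Finset.mem_map, Function.Embedding.coeFn_mk, Prod.mk.injEq]
        constructor
        · intro h
          have hv : v = w := by rcases h with h | h <;> exact h.1
          subst hv
          exact Or.inr ⟨j, rfl⟩
        · rintro (⟨e', h1, h2⟩ | ⟨k, h2⟩)
          · simp at h2
          · have h3 := Sum.inr.inj h2
            have h4 : w = v := congrArg Sigma.fst h3
            cases i <;> simp [h4]
    refine (congrArg Finset.card (Eq.trans ?_ h2)).trans ?_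
    · ext e; simp only [Finset.mem_filter, Finset.mem_univ, true_and]
    rw [Finset.card_union_of_disjoint, Finset.card_map, Finset.card_map, h1, Finset.card_univ,
      Fintype.card_fin]
    · have := hdeg w; omega
    · rw [Finset.disjoint_left]
      intro e he he'
      simp only [Finset.mem_map] at he he'
      obtain ⟨a, _, rfl⟩ := he
      obtain ⟨b, _, hb⟩ := he'
      simp at hb)
  obtain ⟨σ, τ, hst⟩ := petersen_perms t h ht hh
  refine ⟨σ, τ, ?_⟩
  intro u v huv
  let e : G.edgeSet := ⟨s(u, v), huv⟩
  have hqe := hq e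
  have h1 := hth (Sum.inl (e, true))
  have h2 := hst (Sum.inl (e, true))
  simp only [e1, e2] at h1
  have h3 : ((q e).1 = u ∧ (q e).2 = v) ∨ ((q e).1 = v ∧ (q e).2 = u) := by
    have : s((q e).1, (q e).2) = s(u, v) := hqe
    exact Sym2.eq_iff.1 this
  rcases h1 with ⟨h1, h1'⟩ | ⟨h1, h1'⟩ <;> rw [h1, h1'] at h2 <;>
    rcases h3 with ⟨h3, h3'⟩ | ⟨h3, h3'⟩ <;> rw [h3, h3'] at h2 <;> tauto


structure ROrd {W : Type} (σ τ : Equiv.Perm W) (x y : W → ℝ) : Prop where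
  sx : ∀ u v, u ≠ v → x u + 1 ≤ x v ∨ x v + 1 ≤ x u
  sy : ∀ u v, u ≠ v → y u + 1 ≤ y v ∨ y v + 1 ≤ y u
  p1 : ∀ v, x (σ v) = x v + 1 ∨ (x (σ v) ≤ x v ∧ ∀ w, x (σ v) ≤ x w → x w ≤ x v →
    y (σ v) ≤ y w ∧ x (σ v) ≤ x (σ w) ∧ x (σ w) ≤ x v)
  p2 : ∀ v, y (τ v) = y v + 1 ∨ (y (τ v) ≤ y v ∧ ∀ w, y (τ v) ≤ y w → y w ≤ y v →
    x (τ v) ≤ x w ∧ y (τ v) ≤ y (τ w) ∧ y (τ w) ≤ y v)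

variable {W : Type} {σ τ : Equiv.Perm W} {x y : W → ℝ}

theorem ROrd.swap (o : ROrd σ τ x y) : ROrd τ σ y x := ⟨o.sy, o.sx, o.p2, o.p1⟩

theorem ROrd.ex (o : ROrd σ τ x y) {u v : W} (h1 : x u < x v + 1) (h2 : x v < x u + 1) : u = v := by
  by_contra h
  rcases o.sx u v h with h | h <;> linarith

theorem ROrd.ey (o : ROrd σ τ x y) {u v : W} (h1 : y u < y v + 1) (h2 : y v < y u + 1) : u = v :=
  o.swap.ex h1 h2

theorem ROrd.lx (o : ROrd σ τ x y) {u v : W} (h : x u < x v) : x u + 1 ≤ x v := by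
  rcases o.sx u v (by rintro rfl; exact lt_irrefl _ h) with h | h <;> linarith

theorem ROrd.ly (o : ROrd σ τ x y) {u v : W} (h : y u < y v) : y u + 1 ≤ y v := o.swap.lx h

/-- Second coordinate of the bend of the arc `u → σ u`. -/
def vb (σ τ : Equiv.Perm W) (x y : W → ℝ) (u : W) : ℝ :=
  if x u < x (σ u) then
    (if y (σ u) < y u then 3 * y (σ u) + 1
     else if y u < y (τ.symm (σ u)) ∧ y (τ.symm (σ u)) < y (σ u) then 3 * y (τ.symm (σ u)) - 1
     else 3 * y (σ u) - 1)
  else if x (τ (σ u)) < x (σ u) then 3 * y (σ u)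
  else if x (τ (σ u)) ≤ x u then 3 * y (σ u) - 1
  else 3 * y (σ u) + 1

/-- Closing condition. -/
def Clo (σ : Equiv.Perm W) (x y : W → ℝ) (u : W) : Prop :=
  ∀ w, x (σ u) ≤ x w → x w ≤ x u → y (σ u) ≤ y w ∧ x (σ u) ≤ x (σ w) ∧ x (σ w) ≤ x u

theorem vb_cases (o : ROrd σ τ x y) (u : W) (hu : u ≠ σ u) :
    (x (σ u) = x u + 1 ∧
      ((y (σ u) + 1 ≤ y u ∧ vb σ τ x y u = 3 * y (σ u) + 1) ∨
       (∃ a, τ a = σ u ∧ y u + 1 ≤ y a ∧ y (σ u) = y a + 1 ∧ vb σ τ x y u = 3 * y a - 1) ∨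
       (y u + 1 ≤ y (σ u) ∧ vb σ τ x y u = 3 * y (σ u) - 1 ∧
          ∀ a, τ a = σ u → y a ≤ y u ∨ y (σ u) ≤ y a))) ∨
    (x (σ u) + 1 ≤ x u ∧ Clo σ x y u ∧
      ((x (τ (σ u)) + 1 ≤ x (σ u) ∧ vb σ τ x y u = 3 * y (σ u)) ∨
       (x (σ u) ≤ x (τ (σ u)) ∧ x (τ (σ u)) ≤ x u ∧ vb σ τ x y u = 3 * y (σ u) - 1) ∨
       (x u + 1 ≤ x (τ (σ u)) ∧ vb σ τ x y u = 3 * y (σ u) + 1))) := by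
  rcases o.p1 u with h | ⟨h, h'⟩
  · left
    refine ⟨h, ?_⟩
    have h1 : x u < x (σ u) := by linarith
    by_cases h2 : y (σ u) < y u
    · left; exact ⟨o.ly h2, by simp [vb, h1, h2]⟩
    · by_cases h3 : y u < y (τ.symm (σ u)) ∧ y (τ.symm (σ u)) < y (σ u)
      · right; left
        refine ⟨τ.symm (σ u), by simp, o.ly h3.1, ?_, by simp only [vb, h1, h2, h3, if_true, if_false, and_self]⟩
        rcases o.p2 (τ.symm (σ u)) with h4 | ⟨h4, _⟩
        · simpa using h4
        · simp at h4; linarith [h3.2]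
      · right; right
        refine ⟨?_, by simp only [vb, h1, h2, h3, if_true, if_false], ?_⟩
        · rcases o.sy u (σ u) hu with h4 | h4
          · exact h4
          · exact absurd (by linarith) h2
        · intro a ha
          rw [← ha] at h3 ⊢
          simp only [Equiv.symm_apply_apply] at h3
          by_contra hcon
          push Not at hcon
          exact h3 hcon
  · right
    have h1 : ¬ x u < x (σ u) := by linarith
    refine ⟨?_, h', ?_⟩
    · rcases o.sx u (σ u) hu with h4 | h4
      · linarith
      · exact h4
    · by_cases h2 : x (τ (σ u)) < x (σ u)
      · left; exact ⟨o.lx h2, by simp only [vb, h1, h2, if_true, if_false]⟩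
      · by_cases h3 : x (τ (σ u)) ≤ x u
        · right; left; exact ⟨by linarith, h3, by simp only [vb, h1, h2, h3, if_true, if_false]⟩
        · right; right; exact ⟨o.lx (by linarith), by simp only [vb, h1, h2, h3, if_false]⟩

def Col (σ τ : Equiv.Perm W) (x y : W → ℝ) (u : W) (zx zy : ℝ) : Prop :=
  zx = 3 * x u ∧ ((3 * y u ≤ zy ∧ zy ≤ vb σ τ x y u) ∨ (vb σ τ x y u ≤ zy ∧ zy ≤ 3 * y u))

def Tail (σ τ : Equiv.Perm W) (x y : W → ℝ) (u : W) (zx zy : ℝ) : Prop :=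
  ∃ l : ℝ, 0 ≤ l ∧ l ≤ 1 ∧ zx = 3 * x (σ u) + l * (3 * x u - 3 * x (σ u)) ∧
    zy = 3 * y (σ u) + l * (vb σ τ x y u - 3 * y (σ u))

def Com (x y : W → ℝ) (u v a b : W) (zx zy : ℝ) : Prop :=
  ∃ w, (w = u ∨ w = v) ∧ (w = a ∨ w = b) ∧ zx = 3 * x w ∧ zy = 3 * y w

theorem Com.symm {u v a b : W} {zx zy : ℝ} (h : Com x y u v a b zx zy) : Com x y a b u v zx zy := by
  obtain ⟨w, h1, h2, h3, h4⟩ := h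
  exact ⟨w, h2, h1, h3, h4⟩

theorem Com.swap {u v a b : W} {zx zy : ℝ} (h : Com x y u v a b zx zy) : Com y x u v a b zy zx := by
  obtain ⟨w, h1, h2, h3, h4⟩ := h
  exact ⟨w, h1, h2, h4, h3⟩

/-- bounds for a tail -/
theorem tail_ord (o : ROrd σ τ x y) {u : W} {zx zy l : ℝ} (hx : x (σ u) = x u + 1)
    (h0 : 0 ≤ l) (h1 : l ≤ 1)
    (hz : zx = 3 * x (σ u) + l * (3 * x u - 3 * x (σ u))) :
    zx = 3 * x (σ u) - 3 * l ∧ 3 * x u ≤ zx ∧ zx ≤ 3 * x (σ u) := by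
  rw [hx] at hz ⊢
  refine ⟨by rw [hz]; ring, by rw [hz]; linarith, by rw [hz]; linarith⟩

theorem vv_colTail (o : ROrd σ τ x y) {u u' : W} {zx zy : ℝ} (hne : u ≠ u')
    (hu : u ≠ σ u) (hu' : u' ≠ σ u')
    (h : Col σ τ x y u zx zy) (h' : Tail σ τ x y u' zx zy) :
    Com x y u (σ u) u' (σ u') zx zy := by
  obtain ⟨hx, hy⟩ := h
  obtain ⟨l, l0, l1, hzx, hzy⟩ := h'
  by_cases huv : u = σ u'
  · have : l = 0 := by
      rw [huv] at hx
      have h2 : l * (3 * x u' - 3 * x (σ u')) = 0 := by linarith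
      rcases mul_eq_zero.1 h2 with h | h
      · exact h
      · exact absurd (o.ex (by linarith) (by linarith)) hu'
    subst this
    exact ⟨u, Or.inl rfl, Or.inr huv, hx, by rw [huv, hzy]; ring⟩
  · exfalso
    rcases vb_cases o u' hu' with ⟨h1, _⟩ | ⟨h1, h2, h3⟩
    · obtain ⟨_, h4, h5⟩ := tail_ord (zy := zy) o h1 l0 l1 hzx
      rcases o.sx u u' hne with h | h
      · linarith
      · rcases o.sx u _ huv with h | h <;> linarith
    · have b1 : x (σ u') ≤ x u := by nlinarith
      have b2 : x u ≤ x u' := by nlinarith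
      obtain ⟨c1, c2, c3⟩ := h2 u b1 b2
      have c4 : y (σ u') + 1 ≤ y u := by
        rcases o.sy _ _ huv with h | h <;> linarith
      have hvx : x (σ u') ≤ x (σ u) := c2
      have hvv : σ u ≠ σ u' := fun h => hne (σ.injective h)
      have c5 : y (σ u') + 1 ≤ y (σ u) := by
        rcases o.sy _ _ hvv with h | h
        · have := (h2 (σ u) c2 c3).1; linarith
        · exact h
      have ub : zy ≤ 3 * y (σ u') + 1 := by
        rcases h3 with ⟨_, h3⟩ | ⟨_, _, h3⟩ | ⟨_, h3⟩ <;> rw [h3] at hzy <;> nlinarith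
      have lb : 3 * y (σ u') + 2 ≤ vb σ τ x y u := by
        rcases vb_cases o u hu with ⟨_, ⟨_, h⟩ | ⟨a, _, _, _, h⟩ | ⟨_, h, _⟩⟩ | ⟨_, _, ⟨_, h⟩ | ⟨_, _, h⟩ | ⟨_, h⟩⟩ <;> linarith
      rcases hy with hy | hy <;> linarith

theorem vv_tailTail (o : ROrd σ τ x y) {u u' : W} {zx zy : ℝ} (hne : u ≠ u')
    (hu : u ≠ σ u) (hu' : u' ≠ σ u')
    (h : Tail σ τ x y u zx zy) (h' : Tail σ τ x y u' zx zy) :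
    Com x y u (σ u) u' (σ u') zx zy := by
  have hvv : σ u ≠ σ u' := fun h => hne (σ.injective h)
  -- ordinary against closing
  have oc : ∀ u u' : W, u ≠ u' → u ≠ σ u → u' ≠ σ u' → Tail σ τ x y u zx zy → Tail σ τ x y u' zx zy →
      x (σ u) = x u + 1 → x (σ u') + 1 ≤ x u' → False := by
    clear hne hu hu' h h' hvv u u'
    rintro u u' hne hu hu' ⟨l, l0, l1, hzx, hzy⟩ ⟨m, m0, m1, hzx', hzy'⟩ ho hc
    have hvv : σ u ≠ σ u' := fun h => hne (σ.injective h)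
    obtain ⟨_, h4, h5⟩ := tail_ord (zy := zy) o ho l0 l1 hzx
    have b1 : 3 * x (σ u') ≤ zx := by nlinarith
    have b2 : zx ≤ 3 * x u' := by nlinarith
    have e1 : x u + 1 ≤ x u' := by rcases o.sx _ _ hne with h | h <;> linarith
    have e2 : x (σ u') ≤ x u := by
      rcases o.sx _ _ hvv with h | h <;> linarith
    rcases vb_cases o u' hu' with ⟨h1, _⟩ | ⟨h1, h2, h3⟩
    · linarith
    have ub : zy ≤ 3 * y (σ u') + 1 := by
      rcases h3 with ⟨_, h3⟩ | ⟨_, _, h3⟩ | ⟨_, h3⟩ <;> rw [h3] at hzy' <;> nlinarith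
    have c1 := (h2 u e2 (by linarith)).1
    have c5 : y (σ u') + 1 ≤ y (σ u) := by
      rcases o.sy _ _ hvv with h | h
      · have := (h2 (σ u) (by linarith) (by linarith)).1; linarith
      · exact h
    have lb : 3 * y (σ u') + 2 ≤ vb σ τ x y u := by
      rcases vb_cases o u hu with ⟨_, ⟨_, h⟩ | ⟨a, _, _, _, h⟩ | ⟨_, h, _⟩⟩ | ⟨_, _, ⟨_, h⟩ | ⟨_, _, h⟩ | ⟨_, h⟩⟩ <;> linarith
    nlinarith
  have cc : ∀ u u' : W, u ≠ u' → u ≠ σ u → u' ≠ σ u' → Tail σ τ x y u zx zy → Tail σ τ x y u' zx zy →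
      x (σ u) + 1 ≤ x u → x (σ u') + 1 ≤ x u' → x (σ u) ≤ x (σ u') → False := by
    clear hne hu hu' h h' hvv u u'
    rintro u u' hne hu hu' ⟨l, l0, l1, hzx, hzy⟩ ⟨m, m0, m1, hzx', hzy'⟩ ho hc hle
    have hvv : σ u ≠ σ u' := fun h => hne (σ.injective h)
    have b1 : 3 * x (σ u') ≤ zx := by nlinarith
    have b2 : zx ≤ 3 * x u := by nlinarith
    rcases vb_cases o u hu with ⟨h1, _⟩ | ⟨h1, h2, h3⟩
    · linarith
    rcases vb_cases o u' hu' with ⟨g1, _⟩ | ⟨g1, g2, g3⟩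
    · linarith
    have ub : zy ≤ 3 * y (σ u) + 1 := by
      rcases h3 with ⟨_, h3⟩ | ⟨_, _, h3⟩ | ⟨_, h3⟩ <;> rw [h3] at hzy <;> nlinarith
    have lb : 3 * y (σ u') - 1 ≤ zy := by
      rcases g3 with ⟨_, h3⟩ | ⟨_, _, h3⟩ | ⟨_, h3⟩ <;> rw [h3] at hzy' <;> nlinarith
    have c5 : y (σ u) + 1 ≤ y (σ u') := by
      rcases o.sy _ _ hvv with h | h
      · exact h
      · have := (h2 (σ u') (by linarith) (by linarith)).1; linarith
    linarith
  rcases o.p1 u with h1 | ⟨h1, _⟩ <;> rcases o.p1 u' with h2 | ⟨h2, _⟩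
  · have oo : ∀ u u' : W, u ≠ σ u → u' ≠ σ u' → Tail σ τ x y u zx zy → Tail σ τ x y u' zx zy →
      x (σ u) = x u + 1 → x (σ u') = x u' + 1 → x u + 1 ≤ x u' → Com x y u (σ u) u' (σ u') zx zy := by
      clear hne hu hu' h h' hvv u u' h1 h2
      rintro u u' hu hu' ⟨l, l0, l1, hzx, hzy⟩ ⟨m, m0, m1, hzx', hzy'⟩ ho hc hle
      obtain ⟨h3, h4, h5⟩ := tail_ord (zy := zy) o ho l0 l1 hzx
      obtain ⟨h3', h4', h5'⟩ := tail_ord (zy := zy) o hc m0 m1 hzx'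
      have : σ u = u' := o.ex (by linarith) (by linarith)
      have hl : l = 0 := by linarith
      subst hl
      exact ⟨σ u, Or.inr rfl, Or.inl this, by linarith, by rw [hzy]; ring⟩
    rcases o.sx _ _ hne with g | g
    · exact oo u u' hu hu' h h' h1 h2 g
    · exact (oo u' u hu' hu h' h h2 h1 g).symm
  · exact (oc u u' hne hu hu' h h' h1 (by rcases o.sx _ _ hu' with g | g <;> linarith)).elim
  · exact (oc u' u hne.symm hu' hu h' h h2 (by rcases o.sx _ _ hu with g | g <;> linarith)).elim
  · have a1 : x (σ u) + 1 ≤ x u := by rcases o.sx _ _ hu with g | g <;> linarith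
    have a2 : x (σ u') + 1 ≤ x u' := by rcases o.sx _ _ hu' with g | g <;> linarith
    rcases le_total (x (σ u)) (x (σ u')) with g | g
    · exact (cc u u' hne hu hu' h h' a1 a2 g).elim
    · exact (cc u' u hne.symm hu' hu h' h a2 a1 g).elim

theorem vv (o : ROrd σ τ x y) {u u' : W} {zx zy : ℝ} (hne : u ≠ u')
    (hu : u ≠ σ u) (hu' : u' ≠ σ u')
    (h : Col σ τ x y u zx zy ∨ Tail σ τ x y u zx zy)
    (h' : Col σ τ x y u' zx zy ∨ Tail σ τ x y u' zx zy) :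
    Com x y u (σ u) u' (σ u') zx zy := by
  rcases h with h | h <;> rcases h' with h' | h'
  · exact absurd (o.ex (by linarith [h.1, h'.1]) (by linarith [h.1, h'.1])) hne
  · exact vv_colTail o hne hu hu' h h'
  · exact (vv_colTail o hne.symm hu' hu h' h).symm
  · exact vv_tailTail o hne hu hu' h h'

theorem vh_cc_aux (o : ROrd σ τ x y) {u a : W} {zx zy : ℝ}
    (hu : u ≠ σ u) (ha : a ≠ τ a) (hs : ¬ (u = τ a ∧ σ u = a)) (hua : u = τ a)
    (h : Col σ τ x y u zx zy) (h' : Col τ σ y x a zy zx) : False := by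
  obtain ⟨hx, hy⟩ := h
  obtain ⟨hy', hx'⟩ := h'
  subst hua
  rcases vb_cases o.swap a ha with ⟨k, ⟨k1, k2⟩ | ⟨b, kb, k1, k2, k3⟩ | ⟨k1, k2, _⟩⟩ | ⟨k, kc, ⟨k1, k2⟩ | ⟨k1, k2, k3⟩ | ⟨k1, k2⟩⟩
  · rcases hx' with g | g <;> linarith
  · rcases hx' with g | g <;> linarith
  · rcases hx' with g | g <;> linarith
  · -- `σ u` is below `u`
    rcases vb_cases o (τ a) hu with ⟨_, ⟨_, q⟩ | ⟨b, _, _, _, q⟩ | ⟨_, q, _⟩⟩ | ⟨_, _, ⟨_, q⟩ | ⟨_, _, q⟩ | ⟨_, q⟩⟩ <;>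
      rcases hy with g | g <;> linarith
  · have hne : σ (τ a) ≠ a := fun h => hs ⟨rfl, h⟩
    have : y (σ (τ a)) + 1 ≤ y a := by
      rcases o.sy _ _ hne with g | g <;> linarith
    rcases vb_cases o (τ a) hu with ⟨_, ⟨_, q⟩ | ⟨b, _, _, _, q⟩ | ⟨_, q, _⟩⟩ | ⟨_, _, ⟨_, q⟩ | ⟨_, _, q⟩ | ⟨_, q⟩⟩ <;>
      rcases hy with g | g <;> linarith
  · have hxa := (kc a (by linarith) le_rfl).1
    have : x (τ a) + 1 ≤ x a := by
      rcases o.sx _ _ ha with g | g <;> linarith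
    rcases hx' with g | g <;> linarith

theorem vh_cc (o : ROrd σ τ x y) {u a : W} {zx zy : ℝ}
    (hu : u ≠ σ u) (ha : a ≠ τ a) (hs : ¬ (u = τ a ∧ σ u = a)) (hs' : ¬ (u = a ∧ σ u = τ a))
    (hM : σ u = τ a → x (σ u) ≤ x u → y (τ a) ≤ y a → x a ≤ x u ∨ y u ≤ y a)
    (h : Col σ τ x y u zx zy) (h' : Col τ σ y x a zy zx)
    (hsh : u = a ∨ u = τ a ∨ σ u = a ∨ σ u = τ a) : Com x y u (σ u) a (τ a) zx zy := by
  rcases hsh with hsh | hsh | hsh | hsh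
  · exact ⟨u, Or.inl rfl, Or.inl hsh, h.1, by rw [hsh]; exact h'.1⟩
  · exact (vh_cc_aux o hu ha hs hsh h h').elim
  · exact (vh_cc_aux o.swap ha hu (fun q => hs ⟨q.2.symm, q.1.symm⟩) hsh.symm h' h).elim
  · exfalso
    obtain ⟨hx, hy⟩ := h
    obtain ⟨hy', hx'⟩ := h'
    have hne : u ≠ a := fun h => hs' ⟨h, hsh⟩
    have hxua := o.sx _ _ hne
    have hyua := o.sy _ _ hne
    rcases vb_cases o u hu with ⟨j, jj⟩ | ⟨j, jc, jj⟩ <;>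
      rcases vb_cases o.swap a ha with ⟨k, kk⟩ | ⟨k, kc, kk⟩
    · rcases jj with ⟨_, q⟩ | ⟨b, qb, _, _, q⟩ | ⟨_, q, q'⟩
      · rw [hsh] at q; rcases hy with g | g <;> rcases hyua with g' | g' <;> rw [hsh] at * <;> linarith
      · have : b = a := τ.injective (qb.trans hsh)
        subst this
        rcases hy with g | g <;> linarith
      · have := q' a hsh.symm
        rw [hsh] at *
        rcases hyua with g' | g'
        · rcases this with t | t <;> linarith
        · exact absurd (o.ey (by linarith) (by linarith)) hu
    · have kx := (kc a (by linarith) le_rfl).1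
      rw [hsh] at *
      rcases kk with ⟨_, q⟩ | ⟨_, _, q⟩ | ⟨_, q⟩ <;> rcases hx' with g | g <;> linarith
    · have jy := (jc u (by linarith) le_rfl).1
      rw [hsh] at *
      rcases jj with ⟨_, q⟩ | ⟨_, _, q⟩ | ⟨_, q⟩ <;> rcases hy with g | g <;> linarith
    · have kx := (kc a (by linarith) le_rfl).1
      have jy := (jc u (by linarith) le_rfl).1
      have kx1 : x (τ a) + 1 ≤ x a := by rcases o.sx _ _ ha with g | g <;> linarith
      have jy1 : y (σ u) + 1 ≤ y u := by rcases o.sy _ _ hu with g | g <;> linarith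
      have m := hM hsh (by linarith) (by linarith)
      rw [hsh] at *
      rcases m with m | m
      · have m' : x a + 1 ≤ x u := by rcases hxua with g | g <;> linarith
        rcases kk with ⟨_, q⟩ | ⟨_, _, q⟩ | ⟨_, q⟩ <;> rcases hx' with g | g <;> linarith
      · have m' : y u + 1 ≤ y a := by rcases hyua with g | g <;> linarith
        rcases jj with ⟨_, q⟩ | ⟨_, _, q⟩ | ⟨_, q⟩ <;> rcases hy with g | g <;> linarith

/-- column of `u` against tail of `a` -/
theorem vh_ct (o : ROrd σ τ x y) {u a : W} {zx zy : ℝ}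
    (hu : u ≠ σ u) (ha : a ≠ τ a) (hs' : ¬ (u = a ∧ σ u = τ a))
    (h : Col σ τ x y u zx zy) (h' : Tail τ σ y x a zy zx) : Com x y u (σ u) a (τ a) zx zy := by
  obtain ⟨hx, hy⟩ := h
  obtain ⟨m, m0, m1, hzy, hzx⟩ := h'
  have fin0 : u = τ a → m = 0 → Com x y u (σ u) a (τ a) zx zy := by
    intro h1 h2
    subst h2
    exact ⟨τ a, Or.inl h1.symm, Or.inr rfl, by rw [hzx]; ring, by rw [hzy]; ring⟩
  rcases vb_cases o.swap a ha with ⟨k, ⟨k1, k2⟩ | ⟨b, kb, k1, k2, k3⟩ | ⟨k1, k2, _⟩⟩ | ⟨k, kc, ⟨k1, k2⟩ | ⟨k1, k2, k3⟩ | ⟨k1, k2⟩⟩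
  · rw [k2] at hzx
    have e : u = τ a := o.ex (by linarith) (by linarith)
    exact fin0 e (by rw [e] at hx; linarith)
  · rw [k3] at hzx
    obtain ⟨g1, g2, g3⟩ := tail_ord (zy := zx) o.swap k m0 m1 hzy
    by_cases e : u = τ a
    · apply fin0 e
      rw [e] at hx
      have : m * (3 * x b - 1 - 3 * x (τ a)) = 0 := by linarith
      rcases mul_eq_zero.1 this with t | t
      · exact t
      · linarith
    · have e2 : u = b := by
        have : x u + 1 ≤ x (τ a) := by
          rcases o.sx _ _ e with t | t
          · exact t
          · nlinarith
        apply o.ex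
        · linarith
        · nlinarith
      subst e2
      exfalso
      have hne : u ≠ a := fun h => hs' ⟨h, kb⟩
      rcases vb_cases o u hu with ⟨j, jj⟩ | ⟨j, jc, jj⟩
      · rcases jj with ⟨_, q⟩ | ⟨c, qb, _, _, q⟩ | ⟨_, q, q'⟩
        · rw [kb] at *
          rcases hy with g | g <;> linarith
        · have : c = a := τ.injective (qb.trans kb)
          subst this
          rcases hy with g | g <;> linarith
        · have := q' a kb.symm
          rw [kb] at *
          rcases o.sy _ _ hne with g' | g'
          · rcases this with t | t <;> linarith
          · linarith [o.ey (u := u) (v := τ a) (by linarith) (by linarith) ▸ hu]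
      · rw [kb] at j; linarith
  · rw [k2] at hzx
    have e : u = τ a := o.ex (by linarith) (by linarith)
    exact fin0 e (by rw [e] at hx; linarith)
  · rw [k2] at hzx
    have e : u = τ a := o.ex (by linarith) (by linarith)
    have c1 : 3 * y (τ a) ≤ zy := by nlinarith
    have c2 : zy ≤ 3 * y (τ a) := by
      subst e
      rcases vb_cases o (τ a) hu with ⟨_, ⟨_, q⟩ | ⟨b, _, _, _, q⟩ | ⟨_, q, _⟩⟩ | ⟨_, _, ⟨_, q⟩ | ⟨_, _, q⟩ | ⟨_, q⟩⟩ <;>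
        rcases hy with g | g <;> linarith
    exact ⟨τ a, Or.inl e.symm, Or.inr rfl, by rw [hzx]; ring, by linarith⟩
  · rw [k3] at hzx
    have e : u = τ a := o.ex (by linarith) (by linarith)
    exact fin0 e (by rw [e] at hx; linarith)
  · rw [k2] at hzx
    have e : u = τ a := o.ex (by linarith) (by linarith)
    exact fin0 e (by rw [e] at hx; linarith)

theorem tt_ord_clo (o : ROrd σ τ x y) {u a : W} {zx zy : ℝ}
    (hu : u ≠ σ u) (ha : a ≠ τ a) (hs : ¬ (u = τ a ∧ σ u = a))
    (h : Tail σ τ x y u zx zy) (h' : Tail τ σ y x a zy zx)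
    (ho : x (σ u) = x u + 1) (hc : y (τ a) + 1 ≤ y a) : Com x y u (σ u) a (τ a) zx zy := by
  obtain ⟨l, l0, l1, hzx, hzy⟩ := h
  obtain ⟨m, m0, m1, hzy', hzx'⟩ := h'
  obtain ⟨e1, e2, e3⟩ := tail_ord (zy := zy) o ho l0 l1 hzx
  rcases vb_cases o.swap a ha with ⟨k, _⟩ | ⟨k, kc, kk⟩
  · linarith
  have hm : m ≤ m * (y a - y (τ a)) := by nlinarith
  have hlo : 3 * y (τ a) + 3 * m ≤ zy := by nlinarith
  have hhi : zy ≤ 3 * y a := by nlinarith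
  have hzm : 3 * x (τ a) - m ≤ zx ∧ zx ≤ 3 * x (τ a) + m := by
    rcases kk with ⟨_, q⟩ | ⟨_, _, q⟩ | ⟨_, q⟩ <;> rw [q] at hzx' <;> constructor <;> linarith
  by_cases hv : σ u = τ a
  · have l3 : 3 * l ≤ m := by rw [hv] at e1; linarith [hzm.1]
    have : m = 0 := by
      rcases vb_cases o u hu with ⟨_, ⟨_, q⟩ | ⟨b, qb, _, _, q⟩ | ⟨_, q, _⟩⟩ | ⟨_, _⟩
      · rw [q, hv] at hzy; linarith
      · have : b = a := τ.injective (qb.trans hv)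
        subst this
        rw [qb] at hc; linarith
      · rw [q, hv] at hzy; linarith
      · linarith
    subst this
    exact ⟨τ a, Or.inr hv.symm, Or.inr rfl, by rw [hzx']; ring, by rw [hzy']; ring⟩
  · have hb : u = τ a := by
      rcases o.sx _ _ hv with g | g
      · linarith [hzm.1]
      · exact o.ex (by linarith [hzm.2]) (by linarith)
    subst hb
    have hne : σ (τ a) ≠ a := fun h => hs ⟨rfl, h⟩
    rcases kk with ⟨k1, q⟩ | ⟨_, _, q⟩ | ⟨k1, q⟩
    · exfalso
      rcases vb_cases o (τ a) hu with ⟨_, ⟨_, q⟩ | ⟨b, qb, _, _, q⟩ | ⟨_, q, _⟩⟩ | ⟨_, _⟩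
      · rw [q] at hzy; linarith
      · linarith
      · linarith
      · linarith
    · rw [q] at hzx'
      have : m = 0 := by linarith
      subst this
      exact ⟨τ a, Or.inl rfl, Or.inr rfl, by rw [hzx']; ring, by rw [hzy']; ring⟩
    · exfalso
      rcases vb_cases o (τ a) hu with ⟨_, ⟨_, q⟩ | ⟨b, qb, b1, b2, q⟩ | ⟨_, q, _⟩⟩ | ⟨_, _⟩
      · linarith
      · have hba : b ≠ a := by rintro rfl; exact hu qb
        have lo : 3 * y b - 1 ≤ zy := by rw [q] at hzy; nlinarith
        rcases o.sy _ _ hba with g | g <;> linarith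
      · rw [q] at hzy; linarith
      · linarith

theorem tt_clo_clo (o : ROrd σ τ x y) {u a : W} {zx zy : ℝ}
    (hu : u ≠ σ u) (ha : a ≠ τ a)
    (h : Tail σ τ x y u zx zy) (h' : Tail τ σ y x a zy zx)
    (ho : x (σ u) + 1 ≤ x u) (hc : y (τ a) + 1 ≤ y a) : Com x y u (σ u) a (τ a) zx zy := by
  obtain ⟨l, l0, l1, hzx, hzy⟩ := h
  obtain ⟨m, m0, m1, hzy', hzx'⟩ := h'
  rcases vb_cases o u hu with ⟨j, _⟩ | ⟨j, jc, jj⟩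
  · linarith
  rcases vb_cases o.swap a ha with ⟨k, _⟩ | ⟨k, kc, kk⟩
  · linarith
  have hm : m ≤ m * (y a - y (τ a)) := by nlinarith
  have hl : l ≤ l * (x u - x (σ u)) := by nlinarith
  have a1 : 3 * y (τ a) + 3 * m ≤ zy := by nlinarith
  have a2 : zy ≤ 3 * y a := by nlinarith
  have a3 : 3 * x (τ a) - m ≤ zx ∧ zx ≤ 3 * x (τ a) + m := by
    rcases kk with ⟨_, q⟩ | ⟨_, _, q⟩ | ⟨_, q⟩ <;> rw [q] at hzx' <;> constructor <;> linarith
  have b1 : 3 * x (σ u) + 3 * l ≤ zx := by nlinarith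
  have b2 : zx ≤ 3 * x u := by nlinarith
  have b3 : 3 * y (σ u) - l ≤ zy ∧ zy ≤ 3 * y (σ u) + l := by
    rcases jj with ⟨_, q⟩ | ⟨_, _, q⟩ | ⟨_, q⟩ <;> rw [q] at hzy <;> constructor <;> linarith
  have hv : σ u = τ a := by
    by_contra hne
    have c1 : x (σ u) ≤ x (τ a) := by
      rcases o.sx _ _ hne with g | g <;> linarith
    have c2 : x (τ a) ≤ x u := by
      by_contra hlt
      have := o.lx (lt_of_not_ge hlt)
      linarith
    have c3 : y (τ a) ≤ y (σ u) := by
      rcases o.sy _ _ hne with g | g <;> linarith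
    have c4 := (jc (τ a) c1 c2).1
    exact hne (o.ey (by linarith) (by linarith))
  have hvx : x (σ u) = x (τ a) := by rw [hv]
  have hvy : y (σ u) = y (τ a) := by rw [hv]
  have : m = 0 := by linarith
  subst this
  exact ⟨τ a, Or.inr hv.symm, Or.inr rfl, by rw [hzx']; ring, by rw [hzy']; ring⟩

theorem tt_long_short (o : ROrd σ τ x y) {u a b : W} {zx zy : ℝ} {l m s t : ℝ}
    (l0 : 0 ≤ l) (l1 : l ≤ 1) (m0 : 0 ≤ m) (m1 : m ≤ 1) (hv : σ u ≠ τ a)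
    (ho : x (σ u) = x u + 1) (hc : y (τ a) = y a + 1)
    (hzx : zx = 3 * x (σ u) - 3 * l) (hzy : zy = 3 * y (σ u) - 4 * l)
    (hyb : y u + 1 ≤ y b) (hyb' : y (σ u) = y b + 1)
    (ht : t = 1 ∨ t = -1)
    (hzx' : zx = 3 * x (τ a) + m * t) (hzy' : zy = 3 * y (τ a) - 3 * m) : False := by
  have hb : u = τ a := by
    rcases o.sx _ _ hv with g | g
    · rcases ht with rfl | rfl <;> linarith
    · rcases ht with rfl | rfl <;> exact o.ex (by linarith) (by linarith)
  have hby : y u = y (τ a) := by rw [← hb]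
  linarith

theorem tt_ord_ord (o : ROrd σ τ x y) {u a : W} {zx zy : ℝ}
    (hu : u ≠ σ u) (ha : a ≠ τ a) (hs : ¬ (u = τ a ∧ σ u = a))
    (h : Tail σ τ x y u zx zy) (h' : Tail τ σ y x a zy zx)
    (ho : x (σ u) = x u + 1) (hc : y (τ a) = y a + 1) : Com x y u (σ u) a (τ a) zx zy := by
  obtain ⟨l, l0, l1, hzx, hzy⟩ := h
  obtain ⟨m, m0, m1, hzy', hzx'⟩ := h'
  obtain ⟨e1, e2, e3⟩ := tail_ord (zy := zy) o ho l0 l1 hzx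
  obtain ⟨f1, f2, f3⟩ := tail_ord (zy := zx) o.swap hc m0 m1 hzy'
  have J : (∃ s, (s = 1 ∨ s = -1) ∧ zy = 3 * y (σ u) + l * s) ∨
      (∃ b, y u + 1 ≤ y b ∧ y (σ u) = y b + 1 ∧ zy = 3 * y (σ u) - 4 * l) := by
    rcases vb_cases o u hu with ⟨_, ⟨_, q⟩ | ⟨b, qb, b1, b2, q⟩ | ⟨_, q, _⟩⟩ | ⟨_, _⟩
    · left; exact ⟨1, Or.inl rfl, by rw [hzy, q]; ring⟩
    · right; exact ⟨b, b1, b2, by rw [hzy, q, b2]; ring⟩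
    · left; exact ⟨-1, Or.inr rfl, by rw [hzy, q]; ring⟩
    · linarith
  have K : (∃ s, (s = 1 ∨ s = -1) ∧ zx = 3 * x (τ a) + m * s) ∨
      (∃ b, x a + 1 ≤ x b ∧ x (τ a) = x b + 1 ∧ zx = 3 * x (τ a) - 4 * m) := by
    rcases vb_cases o.swap a ha with ⟨_, ⟨_, q⟩ | ⟨b, qb, b1, b2, q⟩ | ⟨_, q, _⟩⟩ | ⟨_, _⟩
    · left; exact ⟨1, Or.inl rfl, by rw [hzx', q]; ring⟩
    · right; exact ⟨b, b1, b2, by rw [hzx', q, b2]; ring⟩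
    · left; exact ⟨-1, Or.inr rfl, by rw [hzx', q]; ring⟩
    · linarith
  by_cases hv : σ u = τ a
  · have : m = 0 := by
      have hvx : x (σ u) = x (τ a) := by rw [hv]
      have hvy : y (σ u) = y (τ a) := by rw [hv]
      rcases J with ⟨s, hs, J⟩ | ⟨b, _, _, J⟩ <;> rcases K with ⟨t, ht, K⟩ | ⟨c, _, _, K⟩
      · rcases hs with rfl | rfl <;> rcases ht with rfl | rfl <;> linarith
      · rcases hs with rfl | rfl <;> linarith
      · rcases ht with rfl | rfl <;> linarith
      · linarith
    subst this
    exact ⟨τ a, Or.inr hv.symm, Or.inr rfl, by rw [hzx']; ring, by rw [hzy']; ring⟩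
  · rcases J with ⟨s, hs1, J⟩ | ⟨b, b1, b2, J⟩ <;> rcases K with ⟨t, ht, K⟩ | ⟨c, c1, c2, K⟩
    · exfalso
      apply hs
      constructor
      · rcases o.sx _ _ hv with g | g
        · rcases ht with rfl | rfl <;> linarith
        · rcases ht with rfl | rfl <;> exact o.ex (by linarith) (by linarith)
      · rcases o.sy _ _ hv with g | g
        · rcases hs1 with rfl | rfl <;> exact o.ey (by linarith) (by linarith)
        · rcases hs1 with rfl | rfl <;> linarith
    · exact (tt_long_short o.swap m0 m1 l0 l1 (Ne.symm hv) hc ho f1 K c1 c2 hs1 J e1 (s := s)).elim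
    · exact (tt_long_short o l0 l1 m0 m1 hv ho hc e1 J b1 b2 ht K f1 (s := t)).elim
    · rcases o.sx _ _ hv with g | g
      · rcases o.sy _ _ hv with g' | g'
        · have hm : m = 1 := by linarith
          have hl : l = 0 := by linarith
          have : σ u = a := o.ey (by linarith) (by linarith)
          exact ⟨σ u, Or.inr rfl, Or.inl this, by rw [e1, hl]; ring, by rw [J, hl]; ring⟩
        · exfalso; linarith
      · exfalso
        have hb : u = τ a := o.ex (by linarith) (by linarith)
        have hby : y u = y (τ a) := by rw [← hb]
        linarith

theorem vh_tt (o : ROrd σ τ x y) {u a : W} {zx zy : ℝ}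
    (hu : u ≠ σ u) (ha : a ≠ τ a) (hs : ¬ (u = τ a ∧ σ u = a))
    (h : Tail σ τ x y u zx zy) (h' : Tail τ σ y x a zy zx) : Com x y u (σ u) a (τ a) zx zy := by
  rcases o.p1 u with h1 | ⟨h1, _⟩ <;> rcases o.p2 a with h2 | ⟨h2, _⟩
  · exact tt_ord_ord o hu ha hs h h' h1 h2
  · exact tt_ord_clo o hu ha hs h h' h1 (by rcases o.sy _ _ ha with g | g <;> linarith)
  · exact (tt_ord_clo o.swap ha hu (fun q => hs ⟨q.2.symm, q.1.symm⟩) h' h h2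
      (by rcases o.sx _ _ hu with g | g <;> linarith)).symm.swap
  · exact tt_clo_clo o hu ha h h' (by rcases o.sx _ _ hu with g | g <;> linarith)
      (by rcases o.sy _ _ ha with g | g <;> linarith)

/-- arcs and vertices -/
theorem v_off (o : ROrd σ τ x y) {u w : W} (hu : u ≠ σ u)
    (h : Col σ τ x y u (3 * x w) (3 * y w) ∨ Tail σ τ x y u (3 * x w) (3 * y w)) :
    w = u ∨ w = σ u := by
  rcases h with h | ⟨l, l0, l1, hzx, hzy⟩
  · left; exact o.ex (by linarith [h.1]) (by linarith [h.1])
  · by_contra hcon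
    push Not at hcon
    rcases vb_cases o u hu with ⟨j, _⟩ | ⟨j, jc, jj⟩
    · obtain ⟨e1, e2, e3⟩ := tail_ord (zy := 0) o j l0 l1 hzx
      rcases o.sx _ _ hcon.1 with g | g <;> rcases o.sx _ _ hcon.2 with g' | g' <;> linarith
    · rcases jj with ⟨_, q⟩ | ⟨_, _, q⟩ | ⟨_, q⟩ <;> rw [q] at hzy <;>
        exact hcon.2 (o.ey (by linarith) (by linarith))

structure SpD (σ τ : Equiv.Perm W) (x y : W → ℝ) (h : W → ℕ) (l : W) : Prop where
  min : ∀ w, h w = h l → x (σ l) ≤ x w ∧ y (σ l) ≤ y w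
  rl : x (σ l) < x l
  m : ∀ m, τ m = σ l → y (σ l) < y m ∧ y m < y l ∧ y m < y (σ (σ l))
  tl : x l < x (τ l)
  sr : y (σ (σ l)) ≤ y l
  cl : ∀ u, y (τ u) ≤ y l → y l ≤ y u → y (σ (τ u)) < y (τ u)

structure Full (σ τ : Equiv.Perm W) (x y : W → ℝ) (h : W → ℕ) (Sp : W → Prop) : Prop where
  o : ROrd σ τ x y
  hσ : ∀ v, h (σ v) = h v
  hτ : ∀ v, h (τ v) = h v
  hlt : ∀ u v, h u < h v → x u + 1 ≤ x v ∧ y u + 1 ≤ y v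
  M : ∀ u a, σ u = τ a → x (σ u) ≤ x u → y (τ a) ≤ y a → ¬ Sp u → x a ≤ x u ∨ y u ≤ y a
  sp : ∀ l, Sp l → SpD σ τ x y h l

variable {h : W → ℕ} {Sp : W → Prop}

def SRow (σ : Equiv.Perm W) (x y : W → ℝ) (l : W) (zx zy : ℝ) : Prop :=
  zy = 3 * y l ∧ 3 * x (σ l) - 1 ≤ zx ∧ zx ≤ 3 * x l

def STail (σ : Equiv.Perm W) (x y : W → ℝ) (l : W) (zx zy : ℝ) : Prop :=
  ∃ m, 0 ≤ m ∧ m ≤ 1 ∧ zx = 3 * x (σ l) - m ∧ zy = 3 * y (σ l) + m * (3 * y l - 3 * y (σ l))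

/-- The arc `u` stays in a box. -/
theorem arc_box (o : ROrd σ τ x y) {u : W} {zx zy : ℝ} (hu : u ≠ σ u)
    (h : Col σ τ x y u zx zy ∨ Tail σ τ x y u zx zy) {a b c d : ℝ}
    (h1 : a ≤ x u) (h2 : x u ≤ b) (h3 : a ≤ x (σ u)) (h4 : x (σ u) ≤ b)
    (g1 : c ≤ y u) (g2 : y u ≤ d) (g3 : c ≤ y (σ u)) (g4 : y (σ u) ≤ d) :
    3 * a ≤ zx ∧ zx ≤ 3 * b ∧ 3 * c - 1 ≤ zy ∧ zy ≤ 3 * d + 1 := by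
  have hb : 3 * c - 1 ≤ vb σ τ x y u ∧ vb σ τ x y u ≤ 3 * d + 1 := by
    rcases vb_cases o u hu with ⟨_, ⟨_, q⟩ | ⟨b, _, _, _, q⟩ | ⟨_, q, _⟩⟩ | ⟨_, _, ⟨_, q⟩ | ⟨_, _, q⟩ | ⟨_, q⟩⟩ <;>
      rw [q] <;> constructor <;> linarith
  rcases h with ⟨h, h'⟩ | ⟨l, l0, l1, hzx, hzy⟩
  · refine ⟨by linarith, by linarith, ?_, ?_⟩ <;> rcases h' with h' | h' <;> linarith [hb.1, hb.2]
  · refine ⟨?_, ?_, ?_, ?_⟩ <;> nlinarith [hb.1, hb.2]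

/-- The special arc stays in a box. -/
theorem s_box {l : W} {zx zy : ℝ} (hx : x (σ l) ≤ x l) (hy : y (σ l) ≤ y l)
    (h : SRow σ x y l zx zy ∨ STail σ x y l zx zy) :
    3 * x (σ l) - 1 ≤ zx ∧ zx ≤ 3 * x l ∧ 3 * y (σ l) ≤ zy ∧ zy ≤ 3 * y l := by
  rcases h with ⟨h1, h2, h3⟩ | ⟨m, m0, m1, hzx, hzy⟩
  · refine ⟨?_, ?_, ?_, ?_⟩ <;> linarith
  · refine ⟨?_, ?_, ?_, ?_⟩ <;> nlinarith

theorem vb_up (o : ROrd σ τ x y) {u : W} (hu : u ≠ σ u) (hy : y u ≤ y (σ u)) :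
    vb σ τ x y u ≤ 3 * y (σ u) + 1 := by
  rcases vb_cases o u hu with ⟨_, ⟨_, q⟩ | ⟨b, _, _, _, q⟩ | ⟨_, q, _⟩⟩ | ⟨_, _, ⟨_, q⟩ | ⟨_, _, q⟩ | ⟨_, q⟩⟩ <;>
    rw [q] <;> linarith

theorem s_closing (F : Full σ τ x y h Sp) {l : W} (hl : Sp l) {u : W} (hu : σ u = l) :
    x (σ u) = x u + 1 := by
  rcases F.o.p1 u with g | ⟨g, g'⟩
  · exact g
  · exfalso
    have := (g' l (by rw [hu]) (by rw [← hu]; exact g)).2.1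
    rw [hu] at this
    linarith [(F.sp l hl).rl]

/-- special arc against V arc in the same component -/
theorem sv_same (F : Full σ τ x y h Sp) {l u : W} {zx zy : ℝ} (hl : Sp l) (hul : u ≠ l)
    (hs : ¬ (u = σ l ∧ σ u = l)) (hu : u ≠ σ u) (hh : h u = h l)
    (hS : SRow σ x y l zx zy ∨ STail σ x y l zx zy)
    (hV : Col σ τ x y u zx zy ∨ Tail σ τ x y u zx zy) :
    Com x y l (σ l) u (σ u) zx zy ∨
      (SRow σ x y l zx zy ∧ Col σ τ x y u zx zy ∧
        ¬ (u = l ∨ u = σ l ∨ σ u = l ∨ σ u = σ l)) := by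
  have o := F.o
  have D := F.sp l hl
  have hru := D.min u hh
  have hrv := D.min (σ u) (by rw [F.hσ, hh])
  have hvr : σ u ≠ σ l := fun g => hul (σ.injective g)
  rcases hS with hS | ⟨m, m0, m1, hzx, hzy⟩
  · rcases hV with hV | hV
    · right
      refine ⟨hS, hV, ?_⟩
      obtain ⟨hy1, hx1, hx2⟩ := hS
      obtain ⟨hx, hy⟩ := hV
      rintro (g | g | g | g)
      · exact hul g
      · have g1 : σ u ≠ l := fun q => hs ⟨g, q⟩
        have g2 : y (σ u) ≤ y l := by rw [g]; exact D.sr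
        have g3 : y (σ u) + 1 ≤ y l := by rcases o.sy _ _ g1 with q | q <;> linarith
        have g4 := vb_up o hu (by rw [g]; rw [g] at hrv; exact hrv.2)
        have g5 : y u ≤ y (σ u) := by rw [g]; rw [g] at hrv; exact hrv.2
        rcases hy with q | q <;> linarith
      · have g1 := s_closing F hl g
        rcases vb_cases o u hu with ⟨_, ⟨_, q⟩ | ⟨b, _, _, _, q⟩ | ⟨_, q, _⟩⟩ | ⟨_, _⟩
        · rw [g] at q; rw [g] at *; rcases hy with q | q <;> linarith
        · rw [g] at *; rcases hy with q | q <;> linarith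
        · rw [g] at *; rcases hy with q | q <;> linarith
        · linarith
      · exact hvr g
    · left
      obtain ⟨hy1, hx1, hx2⟩ := hS
      obtain ⟨k, k0, k1, hzx, hzy⟩ := hV
      have fin : σ u = l → k = 0 → Com x y l (σ l) u (σ u) zx zy := by
        intro g g'
        exact ⟨l, Or.inl rfl, Or.inr g.symm, by rw [hzx, g', g]; ring, hy1⟩
      rcases vb_cases o u hu with ⟨j, ⟨_, q⟩ | ⟨b, jb, b1, b2, q⟩ | ⟨_, q, _⟩⟩ | ⟨j, _, jj⟩
      · rw [q] at hzy
        have e : σ u = l := o.ey (by linarith) (by linarith)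
        exact fin e (by rw [e] at hzy; linarith)
      · rw [q] at hzy
        by_cases e : σ u = l
        · apply fin e
          rw [e] at hzy b2
          rw [b2] at hzy
          linarith
        · exfalso
          have e2 : b = l := by
            rcases o.sy _ _ e with g | g
            · nlinarith
            · apply o.ey <;> nlinarith
          obtain ⟨_, d2, _⟩ := tail_ord (zy := zy) o j k0 k1 hzx
          have d4 : x l < x (σ u) := by rw [← jb, e2]; exact D.tl
          rcases o.sx _ _ hul with g | g
          · linarith
          · linarith
      · rw [q] at hzy
        have e : σ u = l := o.ey (by linarith) (by linarith)
        exact fin e (by rw [e] at hzy; linarith)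
      · exfalso
        have e : σ u = l := by
          rcases jj with ⟨_, q⟩ | ⟨_, _, q⟩ | ⟨_, q⟩ <;> rw [q] at hzy <;>
            exact o.ey (by linarith) (by linarith)
        linarith [s_closing F hl e]
  · left
    have b := arc_box o hu hV (a := x (σ l)) (b := max (x u) (x (σ u))) (c := min (y u) (y (σ u)))
      (d := max (y u) (y (σ u))) hru.1 (le_max_left _ _) hrv.1 (le_max_right _ _) (min_le_left _ _)
      (le_max_left _ _) (min_le_right _ _) (le_max_right _ _)
    have hm : m = 0 := by linarith [b.1]
    have e : u = σ l := by
      rcases hV with hV | ⟨k, k0, k1, hzx', _⟩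
      · exact o.ex (by linarith [hV.1]) (by linarith [hV.1])
      · have hrv' : x (σ l) + 1 ≤ x (σ u) := by
          rcases o.sx _ _ hvr with g | g <;> linarith
        by_contra hne
        have hru' : x (σ l) + 1 ≤ x u := by
          rcases o.sx _ _ hne with g | g <;> linarith
        nlinarith
    exact ⟨σ l, Or.inr rfl, Or.inl e.symm, by rw [hzx, hm]; ring, by rw [hzy, hm]; ring⟩

theorem sv (F : Full σ τ x y h Sp) {l u : W} {zx zy : ℝ} (hl : Sp l) (hul : u ≠ l)
    (hs : ¬ (u = σ l ∧ σ u = l)) (hu : u ≠ σ u)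
    (hS : SRow σ x y l zx zy ∨ STail σ x y l zx zy)
    (hV : Col σ τ x y u zx zy ∨ Tail σ τ x y u zx zy) :
    Com x y l (σ l) u (σ u) zx zy ∨
      (SRow σ x y l zx zy ∧ Col σ τ x y u zx zy ∧
        ¬ (u = l ∨ u = σ l ∨ σ u = l ∨ σ u = σ l)) := by
  have D := F.sp l hl
  obtain ⟨s1, s2, s3, s4⟩ := s_box D.rl.le (D.min l rfl).2 hS
  rcases lt_trichotomy (h u) (h l) with g | g | g
  · exfalso
    have q1 := F.hlt u (σ l) (by rw [F.hσ]; exact g)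
    have q2 := F.hlt (σ u) (σ l) (by rw [F.hσ, F.hσ]; exact g)
    have b := arc_box F.o hu hV (a := min (x u) (x (σ u))) (b := x (σ l) - 1) (c := min (y u) (y (σ u)))
      (d := max (y u) (y (σ u))) (min_le_left _ _) (by linarith) (min_le_right _ _) (by linarith) (min_le_left _ _)
      (le_max_left _ _) (min_le_right _ _) (le_max_right _ _)
    linarith [b.2.1]
  · exact sv_same F hl hul hs hu g hS hV
  · exfalso
    have q1 := F.hlt l u g
    have q2 := F.hlt l (σ u) (by rw [F.hσ]; exact g)
    have b := arc_box F.o hu hV (a := min (x u) (x (σ u))) (b := max (x u) (x (σ u))) (c := y l + 1)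
      (d := max (y u) (y (σ u))) (min_le_left _ _) (le_max_left _ _) (min_le_right _ _) (le_max_right _ _) (by linarith)
      (le_max_left _ _) (by linarith) (le_max_right _ _)
    linarith [b.2.2.1]

/-- the bend of an arc leaving towards larger coordinates is not before the tail -/
theorem vb_lo (o : ROrd σ τ x y) {u : W} (hu : u ≠ σ u) (hy : y u < y (σ u)) :
    3 * y u + 2 ≤ vb σ τ x y u := by
  rcases vb_cases o u hu with ⟨_, ⟨_, q⟩ | ⟨b, _, _, _, q⟩ | ⟨_, q, _⟩⟩ | ⟨_, c, ⟨_, q⟩ | ⟨_, _, q⟩ | ⟨_, q⟩⟩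
  · linarith
  · linarith
  · linarith
  all_goals
    have := o.ly hy
    linarith

theorem sh_same (F : Full σ τ x y h Sp) {l a : W} {zx zy : ℝ} (hl : Sp l)
    (ha : a ≠ τ a) (hh : h a = h l)
    (hS : SRow σ x y l zx zy ∨ STail σ x y l zx zy)
    (hH : Col τ σ y x a zy zx ∨ Tail τ σ y x a zy zx) :
    Com x y l (σ l) a (τ a) zx zy ∨
      (SRow σ x y l zx zy ∧ Tail τ σ y x a zy zx ∧ vb τ σ y x a = 3 * x (τ a) ∧
        ¬ (a = l ∨ a = σ l ∨ τ a = l ∨ τ a = σ l)) := by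
  have o := F.o
  have D := F.sp l hl
  have hra := D.min a hh
  have hrb := D.min (τ a) (by rw [F.hτ, hh])
  have hlr := o.lx D.rl
  have finl : a = l → 3 * x l ≤ zx → SRow σ x y l zx zy → Com x y l (σ l) a (τ a) zx zy := by
    intro g g' hS
    exact ⟨l, Or.inl rfl, Or.inl g.symm, by linarith [hS.2.2], hS.1⟩
  rcases hS with hS | ⟨m, m0, m1, hzx, hzy⟩
  · obtain ⟨hy1, hx1, hx2⟩ := hS
    rcases hH with ⟨hy2, hx3⟩ | ⟨k, k0, k1, hzy, hzx⟩
    · left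
      have e : a = l := o.ey (by linarith) (by linarith)
      have v := vb_lo o.swap ha (by rw [e]; exact D.tl)
      refine finl e ?_ ⟨hy1, hx1, hx2⟩
      rw [e] at hx3 v
      rcases hx3 with q | q <;> linarith
    · by_cases eb : τ a = l
      · left
        have hk : k = 0 := by
          rw [eb] at hzy
          have : k * (3 * y a - 3 * y l) = 0 := by linarith
          rcases mul_eq_zero.1 this with t | t
          · exact t
          · exact absurd (o.ey (u := a) (v := τ a) (by rw [eb]; linarith) (by rw [eb]; linarith)) ha
        exact ⟨l, Or.inl rfl, Or.inr eb.symm, by rw [hzx, hk, eb]; ring, hy1⟩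
      · rcases o.p2 a with p | ⟨p, _⟩
        · left
          obtain ⟨d1, d2, d3⟩ := tail_ord (zy := zx) o.swap p k0 k1 hzy
          have e : a = l := by
            apply o.ey
            · linarith
            · rcases o.sy _ _ eb with g | g <;> linarith
          have v := vb_lo o.swap ha (by rw [e]; exact D.tl)
          refine finl e ?_ ⟨hy1, hx1, hx2⟩
          have tl := D.tl
          rw [← e] at tl ⊢
          nlinarith
        · have pb : y (τ a) + 1 ≤ y a := by
            rcases o.sy _ _ ha with g | g <;> linarith
          have c1 : y (τ a) ≤ y l := by nlinarith
          have c2 : y l ≤ y a := by nlinarith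
          have c3 := D.cl a c1 c2
          right
          have hal : a ≠ l := by
            intro e
            have tl := D.tl
            rcases o.p2 a with p | ⟨_, p'⟩
            · linarith
            · have := (p' a (by linarith) le_rfl).1
              rw [e] at this; linarith
          refine ⟨⟨hy1, hx1, hx2⟩, ⟨k, k0, k1, hzy, hzx⟩, ?_, ?_⟩
          · rcases vb_cases o.swap a ha with ⟨q, _⟩ | ⟨_, _, ⟨_, q⟩ | ⟨q, _⟩ | ⟨q, _⟩⟩
            · linarith
            · exact q
            · linarith
            · linarith
          · rintro (e | e | e | e)
            · exact hal e
            · rw [e] at pb hrb; linarith [hrb.2]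
            · exact eb e
            · have := D.m a e
              linarith
  · left
    have key : τ a = σ l → 3 * x (σ l) + 1 ≤ vb τ σ y x a := by
      intro e
      have dm := D.m a e
      rw [← e] at dm
      rcases vb_cases o.swap a ha with ⟨q, _⟩ | ⟨_, _, ⟨q, _⟩ | ⟨_, q, _⟩ | ⟨_, q⟩⟩
      · linarith
      · linarith
      · linarith
      · rw [q, e]
    have key2 : τ a ≠ σ l → 3 * x (σ l) + 2 ≤ vb τ σ y x a := by
      intro e
      have e' : x (σ l) + 1 ≤ x (τ a) := by
        rcases o.sx _ _ e with g | g <;> linarith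
      rcases vb_cases o.swap a ha with ⟨_, ⟨_, q⟩ | ⟨b, _, _, _, q⟩ | ⟨_, q, _⟩⟩ | ⟨_, c, ⟨_, q⟩ | ⟨_, _, q⟩ | ⟨_, q⟩⟩ <;> linarith
    have key3 : 3 * x (σ l) + 1 ≤ vb τ σ y x a := by
      by_cases e : τ a = σ l
      · exact key e
      · linarith [key2 e]
    have lo : 3 * x (σ l) ≤ zx := by
      rcases hH with ⟨_, q | q⟩ | ⟨k, k0, k1, _, q⟩
      · linarith
      · linarith
      · nlinarith
    have hm : m = 0 := by linarith
    have hzr : zy = 3 * y (σ l) := by rw [hzy, hm]; ring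
    have hxr : zx = 3 * x (σ l) := by rw [hzx, hm]; ring
    rcases hH with ⟨q1, q⟩ | ⟨k, k0, k1, q1, q⟩
    · exact ⟨σ l, Or.inr rfl, Or.inl (o.ey (by linarith) (by linarith)), hxr, hzr⟩
    · by_cases e : τ a = σ l
      · exact ⟨σ l, Or.inr rfl, Or.inr e.symm, hxr, hzr⟩
      · exfalso
        have e' : x (σ l) + 1 ≤ x (τ a) := by
          rcases o.sx _ _ e with g | g <;> linarith
        have := key2 e
        nlinarith

theorem sh (F : Full σ τ x y h Sp) {l a : W} {zx zy : ℝ} (hl : Sp l)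
    (ha : a ≠ τ a)
    (hS : SRow σ x y l zx zy ∨ STail σ x y l zx zy)
    (hH : Col τ σ y x a zy zx ∨ Tail τ σ y x a zy zx) :
    Com x y l (σ l) a (τ a) zx zy ∨
      (SRow σ x y l zx zy ∧ Tail τ σ y x a zy zx ∧ vb τ σ y x a = 3 * x (τ a) ∧
        ¬ (a = l ∨ a = σ l ∨ τ a = l ∨ τ a = σ l)) := by
  have D := F.sp l hl
  obtain ⟨s1, s2, s3, s4⟩ := s_box D.rl.le (D.min l rfl).2 hS
  rcases lt_trichotomy (h a) (h l) with g | g | g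
  · exfalso
    have q1 := F.hlt a (σ l) (by rw [F.hσ]; exact g)
    have q2 := F.hlt (τ a) (σ l) (by rw [F.hσ, F.hτ]; exact g)
    have b := arc_box F.o.swap ha hH (a := min (y a) (y (τ a))) (b := max (y a) (y (τ a)))
      (c := min (x a) (x (τ a))) (d := x (σ l) - 1) (min_le_left _ _) (le_max_left _ _)
      (min_le_right _ _) (le_max_right _ _) (min_le_left _ _) (by linarith) (min_le_right _ _) (by linarith)
    linarith [b.2.2.2]
  · exact sh_same F hl ha g hS hH
  · exfalso
    have q1 := F.hlt l a g
    have q2 := F.hlt l (τ a) (by rw [F.hτ]; exact g)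
    have b := arc_box F.o.swap ha hH (a := y l + 1) (b := max (y a) (y (τ a)))
      (c := min (x a) (x (τ a))) (d := max (x a) (x (τ a))) (by linarith) (le_max_left _ _)
      (by linarith) (le_max_right _ _) (min_le_left _ _) (le_max_left _ _) (min_le_right _ _) (le_max_right _ _)
    linarith [b.1]

theorem ss (F : Full σ τ x y h Sp) {l l' : W} {zx zy : ℝ} (hl : Sp l) (hl' : Sp l') (hne : l ≠ l')
    (hS : SRow σ x y l zx zy ∨ STail σ x y l zx zy)
    (hS' : SRow σ x y l' zx zy ∨ STail σ x y l' zx zy) : False := by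
  have D := F.sp l hl
  have D' := F.sp l' hl'
  obtain ⟨s1, s2, s3, s4⟩ := s_box D.rl.le (D.min l rfl).2 hS
  obtain ⟨t1, t2, t3, t4⟩ := s_box D'.rl.le (D'.min l' rfl).2 hS'
  rcases lt_trichotomy (h l) (h l') with g | g | g
  · have := F.hlt l (σ l') (by rw [F.hσ]; exact g)
    linarith
  · have a1 := D.min (σ l') (by rw [F.hσ, g])
    have a2 := D'.min (σ l) (by rw [F.hσ, g])
    exact hne (σ.injective (F.o.ex (by linarith) (by linarith)))
  · have := F.hlt l' (σ l) (by rw [F.hσ]; exact g)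
    linarith

theorem s_off (F : Full σ τ x y h Sp) {l w : W} (hl : Sp l)
    (hS : SRow σ x y l (3 * x w) (3 * y w) ∨ STail σ x y l (3 * x w) (3 * y w)) :
    w = l ∨ w = σ l := by
  rcases hS with ⟨h1, _⟩ | ⟨m, m0, m1, h1, h2⟩
  · left; exact F.o.ey (by linarith) (by linarith)
  · right; exact F.o.ex (by linarith) (by linarith)

/-- The three kinds of drawn arcs. -/
inductive Arc (W : Type) where
  | V (u : W) : Arc W
  | S (u : W) : Arc W
  | H (u : W) : Arc W

def Arc.t : Arc W → W
  | .V u => u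
  | .S u => u
  | .H u => u

def Arc.e (σ τ : Equiv.Perm W) : Arc W → W
  | .V u => σ u
  | .S u => σ u
  | .H u => τ u

def Arc.b (σ τ : Equiv.Perm W) (x y : W → ℝ) : Arc W → Pt
  | .V u => (3 * x u, vb σ τ x y u)
  | .S u => (3 * x (σ u) - 1, 3 * y u)
  | .H u => (vb τ σ y x u, 3 * y u)

def Arc.ok (σ τ : Equiv.Perm W) (Sp : W → Prop) : Arc W → Prop
  | .V u => u ≠ σ u ∧ ¬ Sp u
  | .S u => Sp u
  | .H u => u ≠ τ u

/-- The point of a vertex. -/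
def PP (x y : W → ℝ) (w : W) : Pt := (3 * x w, 3 * y w)

def Arc.seg (σ τ : Equiv.Perm W) (x y : W → ℝ) (A : Arc W) (i : Bool) : Pt × Pt :=
  if i = true then (PP x y A.t, A.b σ τ x y) else (A.b σ τ x y, PP x y (A.e σ τ))

def Arc.on (σ τ : Equiv.Perm W) (x y : W → ℝ) : Arc W → Bool → ℝ → ℝ → Prop
  | .V u, true, zx, zy => Col σ τ x y u zx zy
  | .V u, false, zx, zy => Tail σ τ x y u zx zy
  | .S u, true, zx, zy => SRow σ x y u zx zy
  | .S u, false, zx, zy => STail σ x y u zx zy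
  | .H u, true, zx, zy => Col τ σ y x u zy zx
  | .H u, false, zx, zy => Tail τ σ y x u zy zx

theorem seg_param {a b z : Pt} (hz : z ∈ segment ℝ a b) :
    ∃ l : ℝ, 0 ≤ l ∧ l ≤ 1 ∧ z.1 = b.1 + l * (a.1 - b.1) ∧ z.2 = b.2 + l * (a.2 - b.2) := by
  obtain ⟨s, t, hs, ht, hst, rfl⟩ := hz
  refine ⟨s, hs, by linarith, ?_, ?_⟩ <;> (obtain rfl : t = 1 - s := by linarith) <;> simp <;> ring

theorem between_of {a b l z : ℝ} (l0 : 0 ≤ l) (l1 : l ≤ 1) (hz : z = b + l * (a - b)) :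
    (a ≤ z ∧ z ≤ b) ∨ (b ≤ z ∧ z ≤ a) := by
  rcases le_total a b with g | g
  · left; constructor <;> nlinarith
  · right; constructor <;> nlinarith

theorem Arc.on_of_mem (F : Full σ τ x y h Sp) {A : Arc W} (hA : A.ok σ τ Sp) {i : Bool} {z : Pt}
    (hz : z ∈ segment ℝ (A.seg σ τ x y i).1 (A.seg σ τ x y i).2) : A.on σ τ x y i z.1 z.2 := by
  obtain ⟨l, l0, l1, h1, h2⟩ := seg_param hz
  cases A <;> cases i <;> simp only [Arc.seg, Arc.t, Arc.e, Arc.b, PP, if_true, if_false, Bool.false_eq_true] at h1 h2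
  · exact ⟨l, l0, l1, h1, h2⟩
  · exact ⟨by rw [h1]; ring, between_of l0 l1 h2⟩
  · exact ⟨l, l0, l1, by rw [h1]; ring, by rw [h2]⟩
  · have := (F.sp _ hA).rl
    refine ⟨by rw [h2]; ring, ?_⟩
    rcases between_of l0 l1 h1 with g | g
    · constructor <;> linarith [g.1, g.2]
    · exact g
  · exact ⟨l, l0, l1, h2, h1⟩
  · exact ⟨by rw [h2]; ring, between_of l0 l1 h1⟩

def Arc.vert (σ τ : Equiv.Perm W) (x y : W → ℝ) (A : Arc W) (i : Bool) : Prop :=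
  (A.seg σ τ x y i).1.1 = (A.seg σ τ x y i).2.1
def Arc.hor (σ τ : Equiv.Perm W) (x y : W → ℝ) (A : Arc W) (i : Bool) : Prop :=
  (A.seg σ τ x y i).1.2 = (A.seg σ τ x y i).2.2

def Res (σ τ : Equiv.Perm W) (x y : W → ℝ) (A B : Arc W) (i j : Bool) (zx zy : ℝ) : Prop :=
  Com x y A.t (A.e σ τ) B.t (B.e σ τ) zx zy ∨
   (¬ (A.t = B.t ∨ A.t = B.e σ τ ∨ A.e σ τ = B.t ∨ A.e σ τ = B.e σ τ) ∧
    ((A.vert σ τ x y i ∧ B.hor σ τ x y j) ∨ (A.hor σ τ x y i ∧ B.vert σ τ x y j)))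

theorem Res.symm {A B : Arc W} {i j : Bool} {zx zy : ℝ} (hr : Res σ τ x y A B i j zx zy) :
    Res σ τ x y B A j i zx zy := by
  rcases hr with hr | ⟨h1, h2⟩
  · exact Or.inl hr.symm
  · right
    refine ⟨fun q => h1 ?_, by tauto⟩
    rcases q with q | q | q | q <;> simp [q]

theorem res_vv (F : Full σ τ x y h Sp) {u v : W} {i j : Bool} {zx zy : ℝ}
    (hu : u ≠ σ u) (hv : v ≠ σ v) (hne : u ≠ v)
    (h1 : (Arc.V u).on σ τ x y i zx zy) (h2 : (Arc.V v).on σ τ x y j zx zy) :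
    Res σ τ x y (.V u) (.V v) i j zx zy := by
  left
  refine vv F.o hne hu hv ?_ ?_
  · cases i <;> simp only [Arc.on] at h1 <;> tauto
  · cases j <;> simp only [Arc.on] at h2 <;> tauto

theorem res_hh (F : Full σ τ x y h Sp) {u v : W} {i j : Bool} {zx zy : ℝ}
    (hu : u ≠ τ u) (hv : v ≠ τ v) (hne : u ≠ v)
    (h1 : (Arc.H u).on σ τ x y i zx zy) (h2 : (Arc.H v).on σ τ x y j zx zy) :
    Res σ τ x y (.H u) (.H v) i j zx zy := by
  left
  refine (vv F.o.swap hne hu hv ?_ ?_).swap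
  · cases i <;> simp only [Arc.on] at h1 <;> tauto
  · cases j <;> simp only [Arc.on] at h2 <;> tauto

theorem res_vh (F : Full σ τ x y h Sp) {u a : W} {i j : Bool} {zx zy : ℝ}
    (hu : u ≠ σ u) (hsp : ¬ Sp u) (ha : a ≠ τ a)
    (hs : ¬ (u = τ a ∧ σ u = a)) (hs' : ¬ (u = a ∧ σ u = τ a))
    (h1 : (Arc.V u).on σ τ x y i zx zy) (h2 : (Arc.H a).on σ τ x y j zx zy) :
    Res σ τ x y (.V u) (.H a) i j zx zy := by
  cases i <;> cases j <;> simp only [Arc.on] at h1 h2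
  · exact Or.inl (vh_tt F.o hu ha hs h1 h2)
  · exact Or.inl (vh_ct F.o.swap ha hu (fun q => hs' ⟨q.1.symm, q.2.symm⟩) h2 h1).symm.swap
  · exact Or.inl (vh_ct F.o hu ha hs' h1 h2)
  · by_cases hsh : u = a ∨ u = τ a ∨ σ u = a ∨ σ u = τ a
    · exact Or.inl (vh_cc F.o hu ha hs hs' (fun p q r => F.M u a p q r hsp) h1 h2 hsh)
    · right
      refine ⟨hsh, Or.inl ⟨?_, ?_⟩⟩ <;> simp [Arc.vert, Arc.hor, Arc.seg, PP, Arc.t, Arc.b]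

theorem vb_mult (o : ROrd σ τ x y) {u w : W} (hu : u ≠ σ u) (hv : vb σ τ x y u = 3 * y w) : w = σ u := by
  by_contra hne
  rcases vb_cases o u hu with ⟨_, ⟨_, q⟩ | ⟨b, _, _, _, q⟩ | ⟨_, q, _⟩⟩ | ⟨_, _, ⟨_, q⟩ | ⟨_, _, q⟩ | ⟨_, q⟩⟩ <;>
    rcases o.sy _ _ hne with g | g <;> try linarith
  all_goals
    rcases eq_or_ne w b with rfl | hb
    · linarith
    · rcases o.sy _ _ hb with g | g <;> linarith

theorem s_bend (F : Full σ τ x y h Sp) {l w : W} {zx zy : ℝ} (hl : Sp l)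
    (h1 : SRow σ x y l zx zy) (h2 : STail σ x y l zx zy) (hw : zx = 3 * x w) : False := by
  have D := F.sp l hl
  have hy := D.min l rfl
  have hlne : l ≠ σ l := by intro q; have := D.rl; rw [← q] at this; exact lt_irrefl _ this
  have hyl : y (σ l) + 1 ≤ y l := by rcases F.o.sy _ _ hlne with g | g <;> linarith
  obtain ⟨m, m0, m1, e1, e2⟩ := h2
  have hm : m = 1 := by
    have := h1.1
    nlinarith
  subst hm
  rcases eq_or_ne w (σ l) with rfl | hne
  · linarith
  · rcases F.o.sx _ _ hne with g | g <;> linarith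

theorem res_sv (F : Full σ τ x y h Sp) {l u : W} {i j : Bool} {zx zy : ℝ}
    (hl : Sp l) (hu : u ≠ σ u) (hsp : ¬ Sp u) (hs : ¬ (u = σ l ∧ σ u = l))
    (h1 : (Arc.S l).on σ τ x y i zx zy) (h2 : (Arc.V u).on σ τ x y j zx zy) :
    Res σ τ x y (.S l) (.V u) i j zx zy := by
  have hul : u ≠ l := by rintro rfl; exact hsp hl
  have hS : SRow σ x y l zx zy ∨ STail σ x y l zx zy := by
    cases i <;> simp only [Arc.on] at h1 <;> tauto
  have hV : Col σ τ x y u zx zy ∨ Tail σ τ x y u zx zy := by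
    cases j <;> simp only [Arc.on] at h2 <;> tauto
  rcases sv F hl hul hs hu hS hV with hc | ⟨c1, c2, c3⟩
  · exact Or.inl hc
  · cases i
    · exact (s_bend F hl c1 h1 c2.1).elim
    · cases j
      · exfalso
        obtain ⟨m, m0, m1, e1, e2⟩ := h2
        have hm : m = 1 := by
          have := c2.1
          have h3 : (1 - m) * (x u - x (σ u)) = 0 := by linarith
          rcases mul_eq_zero.1 h3 with g | g
          · linarith
          · exact absurd (F.o.ex (by linarith) (by linarith)) hu
        subst hm
        have := vb_mult F.o hu (w := l) (by linarith [c1.1])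
        exact c3 (Or.inr (Or.inr (Or.inl this.symm)))
      · right
        refine ⟨fun q => c3 ?_, Or.inr ⟨?_, ?_⟩⟩
        · simp only [Arc.t, Arc.e] at q
          rcases q with q | q | q | q <;> simp [q]
        · simp [Arc.hor, Arc.seg, PP, Arc.t, Arc.b]
        · simp [Arc.vert, Arc.seg, PP, Arc.t, Arc.b]

theorem res_sh (F : Full σ τ x y h Sp) {l a : W} {i j : Bool} {zx zy : ℝ}
    (hl : Sp l) (ha : a ≠ τ a)
    (h1 : (Arc.S l).on σ τ x y i zx zy) (h2 : (Arc.H a).on σ τ x y j zx zy) :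
    Res σ τ x y (.S l) (.H a) i j zx zy := by
  have hS : SRow σ x y l zx zy ∨ STail σ x y l zx zy := by
    cases i <;> simp only [Arc.on] at h1 <;> tauto
  have hV : Col τ σ y x a zy zx ∨ Tail τ σ y x a zy zx := by
    cases j <;> simp only [Arc.on] at h2 <;> tauto
  rcases sh F hl ha hS hV with hc | ⟨c1, c2, c3, c4⟩
  · exact Or.inl hc
  · cases i
    · obtain ⟨m, m0, m1, e1, e2⟩ := c2
      exact (s_bend F hl c1 h1 (w := τ a) (by rw [e2, c3]; ring)).elim
    · cases j
      · right
        refine ⟨fun q => c4 ?_, Or.inr ⟨?_, ?_⟩⟩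
        · simp only [Arc.t, Arc.e] at q
          rcases q with q | q | q | q <;> simp [q]
        · simp [Arc.hor, Arc.seg, PP, Arc.t, Arc.b]
        · simp [Arc.vert, Arc.seg, PP, Arc.t, Arc.b, Arc.e, c3]
      · have e1 := c1.1
        have e2 := h2.1
        exact absurd (F.o.ey (u := a) (v := l) (by linarith) (by linarith)) (fun q => c4 (Or.inl q))

theorem res_all (F : Full σ τ x y h Sp) {A B : Arc W} {i j : Bool} {zx zy : ℝ}
    (hA : A.ok σ τ Sp) (hB : B.ok σ τ Sp) (hne : s(A.t, A.e σ τ) ≠ s(B.t, B.e σ τ))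
    (h1 : A.on σ τ x y i zx zy) (h2 : B.on σ τ x y j zx zy) :
    Res σ τ x y A B i j zx zy := by
  rw [Ne, Sym2.eq_iff, not_or] at hne
  obtain ⟨n1, n2⟩ := hne
  cases A with
  | V u =>
    cases B with
    | V v => exact res_vv F hA.1 hB.1 (by rintro rfl; exact n1 ⟨rfl, rfl⟩) h1 h2
    | S v => exact (res_sv F hB hA.1 hA.2 n2 h2 h1).symm
    | H v => exact res_vh F hA.1 hA.2 hB n2 n1 h1 h2
  | S u =>
    cases B with
    | V v => exact res_sv F hA hB.1 hB.2 (fun q => n2 ⟨q.2.symm, q.1.symm⟩) h1 h2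
    | S v =>
      refine (ss F (zx := zx) (zy := zy) (l := u) (l' := v) hA hB (by rintro rfl; exact n1 ⟨rfl, rfl⟩) ?_ ?_).elim
      · cases i <;> simp only [Arc.on] at h1 <;> tauto
      · cases j <;> simp only [Arc.on] at h2 <;> tauto
    | H v => exact res_sh F hA hB h1 h2
  | H u =>
    cases B with
    | V v => exact (res_vh F hB.1 hB.2 hA (fun q => n2 ⟨q.2.symm, q.1.symm⟩) (fun q => n1 ⟨q.1.symm, q.2.symm⟩) h2 h1).symm
    | S v => exact (res_sh F hB hA h2 h1).symm
    | H v => exact res_hh F hA hB (by rintro rfl; exact n1 ⟨rfl, rfl⟩) h1 h2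

theorem off_all (F : Full σ τ x y h Sp) {A : Arc W} {i : Bool} {w : W}
    (hA : A.ok σ τ Sp) (h1 : A.on σ τ x y i (3 * x w) (3 * y w)) : w = A.t ∨ w = A.e σ τ := by
  cases A with
  | V u => exact v_off F.o hA.1 (by cases i <;> simp only [Arc.on] at h1 <;> tauto)
  | S u => exact s_off F hA (by cases i <;> simp only [Arc.on] at h1 <;> tauto)
  | H u => exact v_off F.o.swap hA (by cases i <;> simp only [Arc.on] at h1 <;> tauto)

theorem vb_int (hx : ∀ w, ∃ k : ℤ, y w = k) (u : W) : ∃ k : ℤ, vb σ τ x y u = k := by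
  obtain ⟨k, hk⟩ := hx (σ u)
  obtain ⟨m, hm⟩ := hx (τ.symm (σ u))
  unfold vb
  rw [hk, hm]
  split_ifs
  · exact ⟨3 * k + 1, by push_cast; ring⟩
  · exact ⟨3 * m - 1, by push_cast; ring⟩
  · exact ⟨3 * k - 1, by push_cast; ring⟩
  · exact ⟨3 * k, by push_cast; ring⟩
  · exact ⟨3 * k - 1, by push_cast; ring⟩
  · exact ⟨3 * k + 1, by push_cast; ring⟩

theorem vb_bd {N : ℝ} (hx : ∀ w, 0 ≤ y w ∧ y w ≤ N) (u : W) :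
    -1 ≤ vb σ τ x y u ∧ vb σ τ x y u ≤ 3 * N + 1 := by
  have h1 := hx (σ u)
  have h2 := hx (τ.symm (σ u))
  unfold vb
  split_ifs <;> constructor <;> linarith

theorem poly_segs (A : Arc W) (s : Pt × Pt) :
    s ∈ polySegs [PP x y A.t, A.b σ τ x y, PP x y (A.e σ τ)] ↔ ∃ i, s = A.seg σ τ x y i := by
  simp [polySegs, Arc.seg, or_comm]

theorem poly_set (A : Arc W) (z : Pt) :
    z ∈ polySet [PP x y A.t, A.b σ τ x y, PP x y (A.e σ τ)] ↔
      ∃ i, z ∈ segment ℝ (A.seg σ τ x y i).1 (A.seg σ τ x y i).2 := by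
  simp only [polySet, Set.mem_iUnion, poly_segs]
  constructor
  · rintro ⟨s, ⟨i, rfl⟩, hs⟩; exact ⟨i, hs⟩
  · rintro ⟨i, hs⟩; exact ⟨_, ⟨i, rfl⟩, hs⟩

theorem assemble {V : Type} [Fintype V] (G : SimpleGraph V) (F : Full σ τ x y h Sp)
    (ix : ∀ w, ∃ k : ℤ, x w = k) (iy : ∀ w, ∃ k : ℤ, y w = k)
    (bx : ∀ w, 0 ≤ x w ∧ x w ≤ 2 * Fintype.card V) (bY : ∀ w, 0 ≤ y w ∧ y w ≤ 2 * Fintype.card V)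
    (f : V → W) (hf : Function.Injective f)
    (hG : ∀ u v, G.Adj u v → (f v = σ (f u) ∨ f u = σ (f v) ∨ f v = τ (f u) ∨ f u = τ (f v))) :
    ∃ (p : V → Pt) (poly : Sym2 V → List Pt), IsBendRACDrawing 1 G p poly ∧
          InGridSquare (10 * (Fintype.card V : ℝ)) (drawingPoints G p poly) := by
  have harc : ∀ e : G.edgeSet, ∃ A : Arc W, ∃ u v, e.1 = s(u, v) ∧ A.t = f u ∧ A.e σ τ = f v ∧ A.ok σ τ Sp := by
    rintro ⟨e, he⟩
    induction e with
    | _ u v =>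
    have key : ∀ u v, G.Adj u v → (f v = σ (f u) ∨ f v = τ (f u)) →
        ∃ A : Arc W, A.t = f u ∧ A.e σ τ = f v ∧ A.ok σ τ Sp := by
      intro u v huv hh
      have hne : f u ≠ f v := fun q => huv.ne (hf q)
      rcases hh with hh | hh
      · by_cases hs : Sp (f u)
        · exact ⟨.S (f u), rfl, hh.symm, hs⟩
        · exact ⟨.V (f u), rfl, hh.symm, by rw [← hh]; exact hne, hs⟩
      · exact ⟨.H (f u), rfl, hh.symm, by show f u ≠ τ (f u); rw [← hh]; exact hne⟩
    have huv : G.Adj u v := he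
    rcases hG u v huv with q | q | q | q
    · obtain ⟨A, h1⟩ := key u v huv (Or.inl q); exact ⟨A, u, v, rfl, h1⟩
    · obtain ⟨A, h1⟩ := key v u huv.symm (Or.inl q); exact ⟨A, v, u, Sym2.eq_swap, h1⟩
    · obtain ⟨A, h1⟩ := key u v huv (Or.inr q); exact ⟨A, u, v, rfl, h1⟩
    · obtain ⟨A, h1⟩ := key v u huv.symm (Or.inr q); exact ⟨A, v, u, Sym2.eq_swap, h1⟩
  choose A hA using harc
  let p : V → Pt := fun v => PP x y (f v)
  let poly : Sym2 V → List Pt := fun e => if he : e ∈ G.edgeSet then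
    [PP x y (A ⟨e, he⟩).t, (A ⟨e, he⟩).b σ τ x y, PP x y ((A ⟨e, he⟩).e σ τ)] else []
  have hpoly : ∀ e (he : e ∈ G.edgeSet), poly e =
    [PP x y (A ⟨e, he⟩).t, (A ⟨e, he⟩).b σ τ x y, PP x y ((A ⟨e, he⟩).e σ τ)] := fun e he => dif_pos he
  have hok : ∀ e (he : e ∈ G.edgeSet), (A ⟨e, he⟩).ok σ τ Sp := by
    intro e he
    obtain ⟨u, v, h1, h2, h3, h4⟩ := hA ⟨e, he⟩
    exact h4
  have hPinj : ∀ a b, PP x y a = PP x y b → a = b := by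
    intro a b hab
    have := congrArg Prod.fst hab
    simp only [PP] at this
    exact F.o.ex (by linarith) (by linarith)
  have hmem : ∀ e (he : e ∈ G.edgeSet) (w : V), w ∈ e ↔ (f w = (A ⟨e, he⟩).t ∨ f w = (A ⟨e, he⟩).e σ τ) := by
    intro e he w
    obtain ⟨u, v, h1, h2, h3, h4⟩ := hA ⟨e, he⟩
    simp only at h1
    rw [h2, h3, h1, Sym2.mem_iff, hf.eq_iff, hf.eq_iff]
  have hWmem : ∀ e (he : e ∈ G.edgeSet) (w : W), (w = (A ⟨e, he⟩).t ∨ w = (A ⟨e, he⟩).e σ τ) → ∃ v ∈ e, f v = w := by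
    intro e he w hw
    obtain ⟨u, v, h1, h2, h3, h4⟩ := hA ⟨e, he⟩
    simp only at h1
    rw [h2, h3] at hw
    rcases hw with rfl | rfl
    · exact ⟨u, by rw [h1]; simp, rfl⟩
    · exact ⟨v, by rw [h1]; simp, rfl⟩
  have hSym : ∀ e (he : e ∈ G.edgeSet) e' (he' : e' ∈ G.edgeSet), e ≠ e' →
      s((A ⟨e, he⟩).t, (A ⟨e, he⟩).e σ τ) ≠ s((A ⟨e', he'⟩).t, (A ⟨e', he'⟩).e σ τ) := by
    intro e he e' he' hne hq
    obtain ⟨u, v, h1, h2, h3, h4⟩ := hA ⟨e, he⟩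
    obtain ⟨u', v', h1', h2', h3', h4'⟩ := hA ⟨e', he'⟩
    simp only at h1 h1'
    rw [h2, h3, h2', h3'] at hq
    apply hne
    rw [h1, h1', Sym2.eq_iff]
    rw [Sym2.eq_iff] at hq
    simpa [hf.eq_iff] using hq
  have main : ∀ e (he : e ∈ G.edgeSet) e' (he' : e' ∈ G.edgeSet), e ≠ e' → ∀ i j (z : Pt),
      z ∈ segment ℝ ((A ⟨e, he⟩).seg σ τ x y i).1 ((A ⟨e, he⟩).seg σ τ x y i).2 →
      z ∈ segment ℝ ((A ⟨e', he'⟩).seg σ τ x y j).1 ((A ⟨e', he'⟩).seg σ τ x y j).2 →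
      (∃ w, w ∈ e ∧ w ∈ e' ∧ z = p w) ∨ ((∀ w, w ∈ e → w ∉ e') ∧
        (((A ⟨e, he⟩).vert σ τ x y i ∧ (A ⟨e', he'⟩).hor σ τ x y j) ∨
         ((A ⟨e, he⟩).hor σ τ x y i ∧ (A ⟨e', he'⟩).vert σ τ x y j))) := by
    intro e he e' he' hne i j z hz hz'
    rcases res_all F (hok e he) (hok e' he') (hSym e he e' he' hne) (Arc.on_of_mem F (hok e he) hz)
      (Arc.on_of_mem F (hok e' he') hz') with ⟨w, w1, w2, w3, w4⟩ | ⟨c1, c2⟩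
    · left
      obtain ⟨v, hv, rfl⟩ := hWmem e he w w1
      exact ⟨v, hv, (hmem e' he' v).2 w2, Prod.ext w3 w4⟩
    · right
      refine ⟨fun w hw hw' => c1 ?_, c2⟩
      rw [hmem e he] at hw
      rw [hmem e' he'] at hw'
      rcases hw with hw | hw <;> rcases hw' with hw' | hw' <;> rw [← hw, ← hw'] <;> simp
  refine ⟨p, poly, ⟨?_, ?_, ?_, ?_, ?_, ?_, ?_⟩, ?_, ?_⟩
  · intro a b hab
    exact hf (hPinj _ _ hab)
  · intro e he
    obtain ⟨u, v, h1, h2, h3, h4⟩ := hA ⟨e, he⟩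
    refine ⟨u, v, h1, ?_, ?_⟩
    · rw [hpoly e he, h2]; rfl
    · rw [hpoly e he, h3]; rfl
  · intro e he
    rw [hpoly e he]; simp
  · intro e he w hw hz
    rw [hpoly e he, poly_set] at hz
    obtain ⟨i, hi⟩ := hz
    exact hw ((hmem e he w).2 (off_all F (hok e he) (Arc.on_of_mem F (hok e he) hi)))
  · intro e he e' he' hne w hw hw' z hz
    rw [hpoly e he, hpoly e' he', Set.mem_inter_iff, poly_set, poly_set] at hz
    obtain ⟨⟨i, hi⟩, ⟨j, hj⟩⟩ := hz
    rcases main e he e' he' hne i j z hi hj with ⟨w', h1, h2, h3⟩ | ⟨h1, _⟩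
    · have : w' = w := by
        by_contra hww
        apply hne
        have e1 := (Sym2.mem_and_mem_iff hww).1 ⟨h1, hw⟩
        have e2 := (Sym2.mem_and_mem_iff hww).1 ⟨h2, hw'⟩
        rw [e1, e2]
      rw [h3, this]; rfl
    · exact absurd hw' (h1 w hw)
  · intro e he e' he' hne
    rw [hpoly e he, hpoly e' he']
    refine Set.Finite.subset (s := (Set.range p) ∪
      (Set.range (fun ij : Bool × Bool => ((((A ⟨e, he⟩).seg σ τ x y ij.1).1.1, ((A ⟨e', he'⟩).seg σ τ x y ij.2).1.2) : Pt)) ∪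
       Set.range (fun ij : Bool × Bool => ((((A ⟨e', he'⟩).seg σ τ x y ij.1).1.1, ((A ⟨e, he⟩).seg σ τ x y ij.2).1.2) : Pt)))) ?_ ?_
    · exact (Set.finite_range _).union ((Set.finite_range _).union (Set.finite_range _))
    · intro z hz
      rw [Set.mem_inter_iff, poly_set, poly_set] at hz
      obtain ⟨⟨i, hi⟩, ⟨j, hj⟩⟩ := hz
      obtain ⟨l, l0, l1, a1, a2⟩ := seg_param hi
      obtain ⟨m, m0, m1, b1, b2⟩ := seg_param hj
      rcases main e he e' he' hne i j z hi hj with ⟨w', h1, h2, h3⟩ | ⟨_, ⟨h1, h2⟩ | ⟨h1, h2⟩⟩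
      · left; exact ⟨w', h3.symm⟩
      · right; left
        refine ⟨(i, j), Prod.ext ?_ ?_⟩
        · rw [a1, ← h1]; simp
        · rw [b2, ← h2]; simp
      · right; right
        refine ⟨(j, i), Prod.ext ?_ ?_⟩
        · rw [b1, ← h2]; simp
        · rw [a2, ← h1]; simp
  · intro e he e' he' hne s hs s' hs' z hz hz' hw
    rw [hpoly e he, poly_segs] at hs
    rw [hpoly e' he', poly_segs] at hs'
    obtain ⟨i, rfl⟩ := hs
    obtain ⟨j, rfl⟩ := hs'
    rcases main e he e' he' hne i j z hz hz' with ⟨w', h1, h2, h3⟩ | ⟨_, ⟨h1, h2⟩ | ⟨h1, h2⟩⟩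
    · exact absurd h3 (hw w' h1 h2)
    · unfold SegOrth; rw [h1, h2]; ring
    · unfold SegOrth; rw [h1, h2]; ring
  · have hPP : ∀ w, ∃ a b : ℤ, PP x y w = ((a : ℝ), (b : ℝ)) := by
      intro w
      obtain ⟨a, ha⟩ := ix w
      obtain ⟨b, hb⟩ := iy w
      exact ⟨3 * a, 3 * b, by simp [PP, ha, hb]⟩
    rintro q (⟨v, rfl⟩ | ⟨e, he, hq⟩)
    · exact hPP _
    · rw [hpoly e he] at hq
      simp only [List.mem_cons, List.not_mem_nil, or_false] at hq
      rcases hq with rfl | rfl | rfl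
      · exact hPP _
      · cases A ⟨e, he⟩ with
        | V u =>
          obtain ⟨a, ha⟩ := ix u
          obtain ⟨b, hb⟩ := vb_int (σ := σ) (τ := τ) (x := x) iy u
          exact ⟨3 * a, b, by simp [Arc.b, ha, hb]⟩
        | S u =>
          obtain ⟨a, ha⟩ := ix (σ u)
          obtain ⟨b, hb⟩ := iy u
          exact ⟨3 * a - 1, 3 * b, by simp [Arc.b, ha, hb]⟩
        | H u =>
          obtain ⟨a, ha⟩ := iy u
          obtain ⟨b, hb⟩ := vb_int (σ := τ) (τ := σ) (x := y) ix u
          exact ⟨b, 3 * a, by simp [Arc.b, ha, hb]⟩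
      · exact hPP _
  · refine ⟨-1, -1, ?_⟩
    have hn : ∀ v : V, (1 : ℝ) ≤ Fintype.card V := by
      intro v
      have : 0 < Fintype.card V := Fintype.card_pos_iff.2 ⟨v⟩
      exact_mod_cast this
    rintro q (⟨v, rfl⟩ | ⟨e, he, hq⟩)
    · have := hn v
      have h1 := bx (f v)
      have h2 := bY (f v)
      simp only [p, PP]
      refine ⟨?_, ?_, ?_, ?_⟩ <;> linarith
    · have hn' : (1 : ℝ) ≤ Fintype.card V := by
        obtain ⟨u, v, h1, h2, h3, h4⟩ := hA ⟨e, he⟩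
        exact hn u
      rw [hpoly e he] at hq
      simp only [List.mem_cons, List.not_mem_nil, or_false] at hq
      have hPP : ∀ w, -1 ≤ (PP x y w).1 ∧ (PP x y w).1 ≤ -1 + 10 * (Fintype.card V : ℝ) ∧
          -1 ≤ (PP x y w).2 ∧ (PP x y w).2 ≤ -1 + 10 * (Fintype.card V : ℝ) := by
        intro w
        have h1 := bx w
        have h2 := bY w
        simp only [PP]
        refine ⟨?_, ?_, ?_, ?_⟩ <;> linarith
      rcases hq with rfl | rfl | rfl
      · exact hPP _
      · cases A ⟨e, he⟩ with
        | V u =>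
          have h1 := bx u
          have h2 := vb_bd (σ := σ) (τ := τ) (x := x) bY u
          simp only [Arc.b]
          refine ⟨?_, ?_, ?_, ?_⟩ <;> linarith
        | S u =>
          have h1 := bx (σ u)
          have h2 := bY u
          simp only [Arc.b]
          refine ⟨?_, ?_, ?_, ?_⟩ <;> linarith
        | H u =>
          have h1 := bY u
          have h2 := vb_bd (σ := τ) (τ := σ) (x := y) bx u
          simp only [Arc.b]
          refine ⟨?_, ?_, ?_, ?_⟩ <;> linarith
      · exact hPP _

/-- Number of steps from `a` to `w` along `σ`. -/
def cpos (σ : Equiv.Perm W) (a w : W) : ℕ := sInf {k | (σ ^ k) a = w}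

/-- First element satisfying `P` along `σ` starting from `a`. -/
def fhit (σ : Equiv.Perm W) (a : W) (P : W → Prop) : W := (σ ^ (sInf {k | P ((σ ^ k) a)})) a

theorem cpos_spec [Finite W] {a w : W} (hs : σ.SameCycle a w) : (σ ^ (cpos σ a w)) a = w :=
  Nat.sInf_mem (s := {k | (σ ^ k) a = w}) hs.exists_nat_pow_eq

theorem cpos_le {a w : W} {k : ℕ} (hk : (σ ^ k) a = w) : cpos σ a w ≤ k := Nat.sInf_le hk

theorem cpos_lt [Finite W] {a w : W} (hs : σ.SameCycle a w) : cpos σ a w < orderOf σ := by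
  obtain ⟨i, hi, h⟩ := hs.exists_pow_eq'
  exact lt_of_le_of_lt (cpos_le h) hi

theorem fhit_same (a : W) (P : W → Prop) : σ.SameCycle a (fhit σ a P) := ⟨((sInf {k | P ((σ ^ k) a)} : ℕ) : ℤ), by rw [zpow_natCast]; rfl⟩

theorem fhit_self {a : W} {P : W → Prop} (ha : P a) : fhit σ a P = a := by
  have : sInf {k | P ((σ ^ k) a)} = 0 := Nat.sInf_eq_zero.2 (Or.inl (by simpa using ha))
  simp [fhit, this]

theorem fhit_spec [Finite W] {a w : W} {P : W → Prop} (hs : σ.SameCycle a w) (hw : P w) :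
    P (fhit σ a P) ∧ cpos σ a (fhit σ a P) ≤ cpos σ a w := by
  have hne : {k | P ((σ ^ k) a)}.Nonempty := ⟨cpos σ a w, by simpa [cpos_spec hs] using hw⟩
  refine ⟨Nat.sInf_mem hne, ?_⟩
  have h1 : cpos σ a (fhit σ a P) ≤ sInf {k | P ((σ ^ k) a)} := cpos_le rfl
  refine h1.trans (Nat.sInf_le ?_)
  simpa [cpos_spec hs] using hw

structure Line (σ : Equiv.Perm W) (cc : W → ℕ) (s : W → W) (k : W → ℕ) : Prop where
  inj : ∀ u v, k u = k v → u = v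
  lt : ∀ u v, cc u < cc v → k u < k v
  suc : ∀ v, k (σ v) = k v + 1 ∨ σ v = s v
  cst : ∀ u v, cc u = cc v → s u = s v
  mem : ∀ v, cc (s v) = cc v
  fst : ∀ v, k (s v) ≤ k v
  lst : ∀ v, σ v = s v → ∀ w, cc w = cc v → k w ≤ k v

def lkey (σ : Equiv.Perm W) (cc : W → ℕ) (s : W → W) (v : W) : ℕ := cc v * orderOf σ + cpos σ (s v) v

theorem line_exists [Finite W] (cc : W → ℕ) (hc : ∀ u v, cc u = cc v ↔ σ.SameCycle u v) (s : W → W)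
    (cst : ∀ u v, cc u = cc v → s u = s v) (mem : ∀ v, cc (s v) = cc v) :
    Line σ cc s (lkey σ cc s) := by
  have hsame : ∀ v, σ.SameCycle (s v) v := fun v => (hc _ _).1 (mem v)
  have hlt : ∀ u v, cc u < cc v → lkey σ cc s u < lkey σ cc s v := by
    intro u v huv
    have h1 := cpos_lt (hsame u)
    unfold lkey
    have h2 : (cc u + 1) * orderOf σ ≤ cc v * orderOf σ := Nat.mul_le_mul_right _ huv
    rw [add_mul] at h2
    omega
  refine ⟨?_, hlt, ?_, cst, mem, ?_, ?_⟩
  · intro u v huv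
    rcases lt_trichotomy (cc u) (cc v) with q | q | q
    · have := hlt u v q; omega
    · unfold lkey at huv
      rw [q, Nat.add_left_cancel_iff] at huv
      rw [← cpos_spec (hsame u), ← cpos_spec (hsame v), huv, cst u v q]
    · have := hlt v u q; omega
  · intro v
    by_cases hv : σ v = s v
    · exact Or.inr hv
    · left
      have e1 : cc (σ v) = cc v := (hc _ _).2 (by rw [Equiv.Perm.sameCycle_apply_left])
      have e2 : s (σ v) = s v := cst _ _ e1
      unfold lkey
      rw [e1, e2, add_assoc]
      congr 1
      apply le_antisymm
      · apply cpos_le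
        rw [pow_succ', Equiv.Perm.mul_apply, cpos_spec (hsame v)]
      · have h1 : σ.SameCycle (s v) (σ v) := e2 ▸ hsame (σ v)
        have h2 := cpos_spec h1
        rcases hj : cpos σ (s v) (σ v) with _ | j
        · rw [hj] at h2; exact absurd h2.symm hv
        · rw [hj, pow_succ', Equiv.Perm.mul_apply] at h2
          have := cpos_le (σ.injective h2)
          omega
  · intro v
    have h0 : cpos σ (s v) (s v) = 0 := Nat.le_zero.1 (cpos_le (by simp))
    unfold lkey
    rw [cst _ _ (mem v), mem v, h0]
    omega
  · intro v hv w hw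
    unfold lkey
    rw [cst _ _ hw, hw]
    have hp : (σ ^ (cpos σ (s v) v + 1)) (s v) = s v := by
      rw [pow_succ', Equiv.Perm.mul_apply, cpos_spec (hsame v), hv]
    have hsw : σ.SameCycle (s v) w := cst _ _ hw ▸ hsame w
    set n := cpos σ (s v) v + 1 with hn
    have hmod : (σ ^ (cpos σ (s v) w % n)) (s v) = w := by
      have h1 := cpos_spec hsw
      rw [← Nat.mod_add_div (cpos σ (s v) w) n, pow_add, Equiv.Perm.mul_apply, pow_mul] at h1
      rwa [Equiv.Perm.pow_apply_eq_self_of_apply_eq_self hp] at h1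
    have h2 := cpos_le hmod
    have h3 := Nat.mod_lt (cpos σ (s v) w) (show 0 < n by omega)
    omega

/-- Rank with respect to a key. -/
def rk {L : Type} [LinearOrder L] [Fintype W] (k : W → L) (v : W) : ℕ := (Finset.univ.filter fun w => k w < k v).card

theorem rk_lt {L : Type} [LinearOrder L] [Fintype W] (k : W → L) (u v : W) : rk k u < rk k v ↔ k u < k v := by
  have h1 : ∀ u v, k u < k v → rk k u < rk k v := by
    intro u v huv
    apply Finset.card_lt_card
    refine ⟨fun w hw => ?_, fun hss => ?_⟩
    · simp only [Finset.mem_filter, Finset.mem_univ, true_and] at hw ⊢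
      exact hw.trans huv
    · have := hss (show u ∈ _ by simpa using huv)
      simp at this
  refine ⟨fun hr => ?_, h1 u v⟩
  by_contra hcon
  rcases (not_lt.1 hcon).lt_or_eq with q | q
  · exact absurd (h1 v u q) (by omega)
  · unfold rk at hr; rw [q] at hr; exact lt_irrefl _ hr

theorem rk_le {L : Type} [LinearOrder L] [Fintype W] (k : W → L) (u v : W) : rk k u ≤ rk k v ↔ k u ≤ k v := by
  rw [← not_lt, rk_lt, not_lt]

theorem rk_eq {L : Type} [LinearOrder L] [Fintype W] (k : W → L) (u v : W) : rk k u = rk k v ↔ k u = k v := by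
  rw [le_antisymm_iff, rk_le, rk_le, ← le_antisymm_iff]

theorem rk_card {L : Type} [LinearOrder L] [Fintype W] (k : W → L) (v : W) : rk k v ≤ Fintype.card W :=
  Finset.card_le_univ _

theorem Line.rank [Fintype W] {cc : W → ℕ} {s : W → W} {k : W → ℕ} (H : Line σ cc s k) :
    Line σ cc s (rk k) := by
  refine ⟨fun u v huv => H.inj u v ((rk_eq k u v).1 huv), fun u v huv => (rk_lt k u v).2 (H.lt u v huv), ?_,
    H.cst, H.mem, fun v => (rk_le _ _ _).2 (H.fst v), fun v hv w hw => (rk_le _ _ _).2 (H.lst v hv w hw)⟩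
  intro v
  rcases H.suc v with h1 | h1
  · left
    unfold rk
    have : (Finset.univ.filter fun w => k w < k (σ v)) = insert v (Finset.univ.filter fun w => k w < k v) := by
      ext w
      simp only [Finset.mem_filter, Finset.mem_univ, true_and, Finset.mem_insert, h1]
      constructor
      · intro q
        rcases (Nat.lt_succ_iff.1 q).lt_or_eq with g | g
        · exact Or.inr g
        · exact Or.inl (H.inj _ _ g)
      · rintro (rfl | q) <;> omega
    rw [this, Finset.card_insert_of_notMem (by simp)]
  · exact Or.inr h1

theorem class_argmin [Finite W] (cc dd : W → ℕ) :
    ∃ R : W → W, (∀ v, cc (R v) = cc v) ∧ (∀ v w, cc w = cc v → dd (R v) ≤ dd w) ∧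
      (∀ u v, cc u = cc v → R u = R v) := by
  have key : ∀ n : ℕ, (∃ v, cc v = n) → ∃ a, cc a = n ∧ ∀ w, cc w = n → dd a ≤ dd w := by
    rintro n ⟨v, hv⟩
    obtain ⟨a, ha, hm⟩ := Set.exists_min_image {w | cc w = n} dd (Set.toFinite _) ⟨v, hv⟩
    exact ⟨a, ha, hm⟩
  by_cases hW : Nonempty W
  · choose! f hf using key
    have hf' : ∀ v, _ := fun v => hf (cc v) ⟨v, rfl⟩
    exact ⟨fun v => f (cc v), fun v => (hf' v).1, fun v w hw => (hf' v).2 w hw, fun u v huv => congrArg f huv⟩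
  · exact ⟨id, fun v => rfl, fun v => absurd ⟨v⟩ hW, fun v => absurd ⟨v⟩ hW⟩

/-- Recursive choice of starting points. -/
def starts (σ τ : Equiv.Perm W) (cc dd : W → ℕ) (R Q : W → W) (v : W) : W :=
  if cc (Q (R v)) < cc v then
    fhit τ (fhit σ (starts σ τ cc dd R Q (Q (R v))) (fun w => dd w = dd (R v))) (fun w => cc w = cc v)
  else R v
termination_by cc v

theorem starts_spec [Fintype W] (cc dd : W → ℕ) (hc : ∀ u v, cc u = cc v ↔ σ.SameCycle u v)
    (hd : ∀ u v, dd u = dd v ↔ τ.SameCycle u v) (R : W → W) (R1 : ∀ v, cc (R v) = cc v)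
    (R2 : ∀ v w, cc w = cc v → dd (R v) ≤ dd w) (R3 : ∀ u v, cc u = cc v → R u = R v) :
    ∃ (s g : W → W) (x y : W → ℕ), Line σ cc s x ∧ Line τ dd g y ∧ (∀ v, y (s v) ≤ y v) ∧ (∀ v, x (g v) ≤ x v) ∧
      (∀ v, x v ≤ Fintype.card W) ∧ (∀ v, y v ≤ Fintype.card W) ∧
      ∀ v, (∀ w, dd w = dd (R v) → cc v ≤ cc w) → s v = R v ∧ g (R v) = R v := by
  obtain ⟨Q, Q1, Q2, Q3⟩ := class_argmin dd cc
  set s := starts σ τ cc dd R Q with hs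
  have hsv : ∀ v, s v = if cc (Q (R v)) < cc v then
    fhit τ (fhit σ (s (Q (R v))) (fun w => dd w = dd (R v))) (fun w => cc w = cc v) else R v := by
    intro v; rw [hs]; rw [starts]
  have scst : ∀ u v, cc u = cc v → s u = s v := by
    intro u v huv
    rw [hsv u, hsv v, R3 u v huv, huv]
  let g : W → W := fun v => fhit σ (s (Q v)) (fun w => dd w = dd v)
  have gcst : ∀ u v, dd u = dd v → g u = g v := by
    intro u v huv
    simp only [g]
    rw [Q3 u v huv, huv]
  have elseCase : ∀ v, ¬ cc (Q (R v)) < cc v → s v = R v ∧ g (R v) = R v := by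
    intro v hv
    have h1 : s v = R v := by rw [hsv, if_neg hv]
    have h2 : cc (Q (R v)) = cc v := by
      have := Q2 (R v) (R v) rfl
      rw [R1] at this
      omega
    refine ⟨h1, ?_⟩
    simp only [g]
    rw [scst _ _ h2, h1]
    exact fhit_self rfl
  have suni : ∀ v, s v = fhit τ (g (R v)) (fun w => cc w = cc v) := by
    intro v
    by_cases hv : cc (Q (R v)) < cc v
    · rw [hsv, if_pos hv]
    · obtain ⟨h1, h2⟩ := elseCase v hv
      rw [h2, h1]
      exact (fhit_self (P := fun w => cc w = cc v) (R1 v)).symm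
  have gmem0 : ∀ v, cc (s (Q v)) = cc (Q v) → dd (g v) = dd v := fun v hv =>
    (fhit_spec (P := fun w => dd w = dd v) ((hc _ _).1 hv) (Q1 v)).1
  have hgR : ∀ v, dd (g (R v)) = dd (R v) → cc (s v) = cc v := by
    intro v hv
    rw [suni]
    exact (fhit_spec (P := fun w => cc w = cc v) ((hd _ _).1 hv) (R1 v)).1
  have smem : ∀ n v, cc v = n → cc (s v) = cc v := by
    intro n
    induction n using Nat.strong_induction_on with
    | _ n ih =>
      intro v hv
      by_cases hlt : cc (Q (R v)) < cc v
      · exact hgR v (gmem0 _ (ih _ (hv ▸ hlt) _ rfl))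
      · rw [(elseCase v hlt).1, R1]
  have gmem : ∀ v, dd (g v) = dd v := fun v => gmem0 v (smem _ _ rfl)
  have L1 := line_exists cc hc s scst (fun v => smem _ v rfl)
  have L2 := line_exists dd hd g gcst gmem
  refine ⟨s, g, rk (lkey σ cc s), rk (lkey τ dd g), L1.rank, L2.rank, ?_, ?_, fun v => rk_card _ _, fun v => rk_card _ _, ?_⟩
  · intro v
    rw [rk_le]
    have h0 : dd (s v) = dd (R v) := by
      rw [← gmem (R v), suni v]
      exact ((hd _ _).2 (fhit_same _ _)).symm
    rcases (R2 v v rfl).lt_or_eq with q | q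
    · exact (L2.lt _ _ (h0 ▸ q)).le
    · unfold lkey
      rw [h0, q, gcst (s v) v (h0.trans q)]
      have := (fhit_spec (P := fun w => cc w = cc v) (a := g v) (w := v) ((hd _ _).1 (gmem v)) rfl).2
      rw [suni v, gcst _ _ q]
      omega
  · intro v
    rw [rk_le]
    have h0 : cc (g v) = cc (Q v) := by
      rw [← smem _ (Q v) rfl]
      exact ((hc _ _).2 (fhit_same _ _)).symm
    rcases (Q2 v v rfl).lt_or_eq with q | q
    · exact (L1.lt _ _ (h0 ▸ q)).le
    · unfold lkey
      rw [h0, q, scst (g v) v (h0.trans q)]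
      have := (fhit_spec (P := fun w => dd w = dd v) (a := s v) (w := v) ((hc _ _).1 (smem _ v rfl)) rfl).2
      have hg : g v = fhit σ (s v) (fun w => dd w = dd v) := by simp only [g]; rw [scst _ _ q]
      rw [hg]
      omega
  · intro v hv
    exact elseCase v (not_lt.2 (hv _ (Q1 _)))

theorem idx_exists [Finite W] {α : Type} (f : W → α) : ∃ i : W → ℕ, ∀ u v, i u = i v ↔ f u = f v := by
  obtain ⟨n, ⟨e⟩⟩ := Finite.exists_equiv_fin (Set.range f)
  refine ⟨fun v => (e ⟨f v, v, rfl⟩ : ℕ), fun u v => ?_⟩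
  rw [← Fin.ext_iff, e.apply_eq_iff_eq]
  exact Subtype.ext_iff

/-- Lexicographic rank. -/
def rk3 [Fintype W] (a b c : W → ℕ) : W → ℕ := rk (fun v => toLex (a v, toLex (b v, c v)))

theorem rk3_lt [Fintype W] (a b c : W → ℕ) (u v : W) :
    rk3 a b c u < rk3 a b c v ↔ a u < a v ∨ (a u = a v ∧ (b u < b v ∨ (b u = b v ∧ c u < c v))) := by
  unfold rk3
  rw [rk_lt, Prod.Lex.toLex_lt_toLex, Prod.Lex.toLex_lt_toLex]

theorem rk3_eq [Fintype W] (a b c : W → ℕ) (u v : W) :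
    rk3 a b c u = rk3 a b c v ↔ a u = a v ∧ b u = b v ∧ c u = c v := by
  have h1 := rk3_lt a b c u v
  have h2 := rk3_lt a b c v u
  omega

theorem rk3_le [Fintype W] (a b c : W → ℕ) (u v : W) :
    rk3 a b c u ≤ rk3 a b c v ↔ a u < a v ∨ (a u = a v ∧ (b u < b v ∨ (b u = b v ∧ c u ≤ c v))) := by
  have h2 := rk3_lt a b c v u
  omega

def Good (σ τ : Equiv.Perm W) (w : W) : Prop :=
  σ.SameCycle w (τ.symm w) ∨ τ.SameCycle w (σ.symm w)

structure Cyc (σ τ : Equiv.Perm W) (cc dd h : W → ℕ) (r : W → W) : Prop where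
  hc : ∀ u v, cc u = cc v ↔ σ.SameCycle u v
  hd : ∀ u v, dd u = dd v ↔ τ.SameCycle u v
  hcc : ∀ u v, cc u = cc v → h u = h v
  hdd : ∀ u v, dd u = dd v → h u = h v
  hlt : ∀ u v, h u < h v → cc u < cc v ∧ dd u < dd v
  rh : ∀ v, h (r v) = h v
  rc : ∀ u v, h u = h v → r u = r v
  c0 : ∀ v, cc (r v) ≤ cc v
  d0 : ∀ v, dd (r v) ≤ dd v
  step : ∀ v, cc v ≠ cc (r v) → ∃ w w', cc w = cc v ∧ dd w' = dd w ∧ cc w' < cc v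
  mono : ∀ u v, dd u ≤ dd v → ∀ v', dd v' = dd v → ∃ u', dd u' = dd u ∧ cc u' ≤ cc v'
  good : ∀ v, Good σ τ (r v) ∨ ∀ w, h w = h v → ¬ Good σ τ w
  tie : ∀ v w, dd (σ.symm (r v)) ≠ dd (r v) → cc w = cc (r v) → dd w ≤ dd (σ.symm (r v))

theorem cyc_exists [Fintype W] (σ τ : Equiv.Perm W) : ∃ cc dd h r, Cyc σ τ cc dd h r := by
  let G0 : SimpleGraph W := SimpleGraph.fromRel (fun u v => σ.SameCycle u v ∨ τ.SameCycle u v)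
  obtain ⟨h, hh⟩ := idx_exists (fun v => G0.connectedComponentMk v)
  have hh' : ∀ u v, h u = h v ↔ G0.Reachable u v := fun u v => (hh u v).trans SimpleGraph.ConnectedComponent.eq
  obtain ⟨ci, hci⟩ := idx_exists (fun v => Quotient.mk (Equiv.Perm.SameCycle.setoid σ) v)
  obtain ⟨di, hdi⟩ := idx_exists (fun v => Quotient.mk (Equiv.Perm.SameCycle.setoid τ) v)
  have hci' : ∀ u v, ci u = ci v ↔ σ.SameCycle u v := fun u v => (hci u v).trans Quotient.eq
  have hdi' : ∀ u v, di u = di v ↔ τ.SameCycle u v := fun u v => (hdi u v).trans Quotient.eq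
  have hrel : ∀ u v, σ.SameCycle u v ∨ τ.SameCycle u v → h u = h v := by
    intro u v huv
    rw [hh']
    rcases eq_or_ne u v with rfl | hne
    · exact SimpleGraph.Reachable.refl _
    · exact SimpleGraph.Adj.reachable ⟨hne, Or.inl huv⟩
  have hcih : ∀ u v, ci u = ci v → h u = h v := fun u v q => hrel u v (Or.inl ((hci' u v).1 q))
  have hdih : ∀ u v, di u = di v → h u = h v := fun u v q => hrel u v (Or.inr ((hdi' u v).1 q))
  obtain ⟨r, rh, rg, rc⟩ := class_argmin h (fun w => if Good σ τ w then 0 else 1)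
  let lev : W → ℕ := fun v => G0.dist v (r v)
  obtain ⟨R, R1, R2, R3⟩ := class_argmin ci lev
  let cl : W → ℕ := fun v => lev (R v)
  let cc := rk3 h cl ci
  have hcl : ∀ u v, ci u = ci v → cl u = cl v := fun u v q => by simp only [cl]; rw [R3 u v q]
  have hcc : ∀ u v, cc u = cc v ↔ ci u = ci v := by
    intro u v
    simp only [cc]
    rw [rk3_eq]
    exact ⟨fun q => q.2.2, fun q => ⟨hcih u v q, hcl u v q, q⟩⟩
  obtain ⟨Q, Q1, Q2, Q3⟩ := class_argmin di cc
  let mc : W → ℕ := fun v => cc (Q v)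
  let dt : W → ℕ := fun v => if di v = di (r v) then 0 else if di v = di (σ.symm (r v)) then 2 else 1
  let dd := rk3 mc dt di
  have hdd : ∀ u v, dd u = dd v ↔ di u = di v := by
    intro u v
    simp only [dd]
    rw [rk3_eq]
    refine ⟨fun q => q.2.2, fun q => ⟨?_, ?_, q⟩⟩
    · simp only [mc]; rw [Q3 u v q]
    · simp only [dt]; rw [q, rc u v (hdih u v q)]
  have rr : ∀ v, r (r v) = r v := fun v => rc _ _ (rh v)
  have cl0 : ∀ v, cl (r v) = 0 := by
    intro v
    have h1 := R2 (r v) (r v) rfl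
    have h2 : lev (r v) = 0 := by simp only [lev]; rw [rr]; exact SimpleGraph.dist_self
    simp only [cl]
    omega
  have cl1 : ∀ v, cl v = 0 → ci v = ci (r v) := by
    intro v hv
    have h3 : h (R v) = h v := hcih _ _ (R1 v)
    have h1 : G0.Reachable (R v) (r (R v)) := (hh' _ _).1 (rh _).symm
    have h2 : R v = r (R v) := h1.dist_eq_zero_iff.1 hv
    rw [← R1 v, ← rc _ _ h3, ← h2]
  have c0 : ∀ v, cc (r v) ≤ cc v := by
    intro v
    simp only [cc]
    rw [rk3_le]
    right
    refine ⟨rh v, ?_⟩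
    rw [cl0]
    rcases Nat.eq_zero_or_pos (cl v) with q | q
    · right; exact ⟨q.symm, (cl1 v q).ge⟩
    · exact Or.inl q
  have hQ : ∀ v, h (Q v) = h v := fun v => hdih _ _ (Q1 v)
  have dt0 : ∀ v, dt (r v) = 0 := by
    intro v; simp [dt, rr]
  refine ⟨cc, dd, h, r, ⟨?_, ?_, ?_, ?_, ?_, rh, rc, c0, ?_, ?_, ?_, ?_, ?_⟩⟩
  · intro u v; rw [hcc, hci']
  · intro u v; rw [hdd, hdi']
  · intro u v q; exact hcih u v ((hcc u v).1 q)
  · intro u v q; exact hdih u v ((hdd u v).1 q)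
  · intro u v q
    have key : ∀ u v, h u < h v → cc u < cc v := by
      intro u v q
      simp only [cc]
      rw [rk3_lt]; exact Or.inl q
    refine ⟨key u v q, ?_⟩
    simp only [dd]
    rw [rk3_lt]
    left
    exact key _ _ (by rw [hQ, hQ]; exact q)
  · intro v
    have h1 : mc (r v) ≤ mc v := by
      have e1 := Q2 (r v) (r v) rfl
      have e2 := c0 (Q v)
      rw [rc _ _ (hQ v)] at e2
      simp only [mc]; omega
    simp only [dd]
    rw [rk3_le, dt0]
    rcases h1.lt_or_eq with q | q
    · exact Or.inl q
    · right
      refine ⟨q, ?_⟩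
      by_cases q2 : di v = di (r v)
      · right
        have : dt v = 0 := by simp [dt, q2]
        exact ⟨this.symm, q2.ge⟩
      · left
        simp only [dt, if_neg q2]
        split_ifs <;> omega
  · intro v hv
    have hv' : ci v ≠ ci (r v) := fun q => hv ((hcc _ _).2 q)
    have hpos : cl v ≠ 0 := fun q => hv' (cl1 v q)
    have h3 : h (R v) = h v := hcih _ _ (R1 v)
    have h1 : G0.Reachable (R v) (r (R v)) := (hh' _ _).1 (rh _).symm
    obtain ⟨p, hp⟩ := h1.exists_walk_length_eq_dist
    have hp' : p.length = cl v := hp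
    obtain ⟨w, hadj, hdw⟩ : ∃ w, G0.Adj (R v) w ∧ G0.dist w (r (R v)) < cl v := by
      generalize hgen : r (R v) = t at p
      cases p with
      | nil => simp at hp'; exact absurd hp'.symm hpos
      | cons hadj q =>
        refine ⟨_, hadj, ?_⟩
        have := SimpleGraph.dist_le q
        simp at hp'
        omega
    have hadj' : σ.SameCycle (R v) w ∨ τ.SameCycle (R v) w := by
      rcases hadj.2 with q | q
      · exact q
      · exact q.imp (fun z => z.symm) (fun z => z.symm)
    have hw : h w = h (R v) := (hrel _ _ hadj').symm
    have hlev : lev w < cl v := by simp only [lev]; rw [rc _ _ hw]; exact hdw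
    rcases hadj' with q | q
    · exfalso
      have := R2 v w (((hci' _ _).2 q).symm.trans (R1 v))
      simp only [cl] at hlev
      omega
    · refine ⟨R v, w, (hcc _ _).2 (R1 v), (hdd _ _).2 ((hdi' _ _).2 q).symm, ?_⟩
      simp only [cc]
      rw [rk3_lt]
      right
      refine ⟨hw.trans h3, Or.inl (lt_of_le_of_lt ?_ hlev)⟩
      exact R2 w w rfl
  · intro u v huv v' hv'
    refine ⟨Q u, (hdd _ _).2 (Q1 u), ?_⟩
    have h1 : mc u ≤ mc v := by
      simp only [dd] at huv
      rw [rk3_le] at huv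
      rcases huv with q | q
      · exact q.le
      · exact q.1.le
    exact h1.trans (Q2 v v' ((hdd _ _).1 hv'))
  · intro v
    by_cases hg : Good σ τ (r v)
    · exact Or.inl hg
    · right
      intro w hw hgw
      have := rg v w hw
      simp [hg, hgw] at this
  · intro v w hne hw
    have hne' : di (σ.symm (r v)) ≠ di (r v) := fun q => hne ((hdd _ _).2 q)
    have hwr : h w = h v := (hcih _ _ ((hcc _ _).1 hw)).trans (rh v)
    have hsr : h (σ.symm (r v)) = h v := (hrel _ _ (Or.inl (by rw [Equiv.Perm.sameCycle_symm_apply_left]))).trans (rh v)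
    have h1 : mc w ≤ mc (σ.symm (r v)) := by
      have e1 := Q2 w w rfl
      have e2 := c0 (Q (σ.symm (r v)))
      rw [rc _ _ ((hQ _).trans hsr)] at e2
      simp only [mc]; omega
    have h2 : dt (σ.symm (r v)) = 2 := by
      simp only [dt]
      rw [rc _ _ hsr, if_neg hne', if_pos rfl]
    simp only [dd]
    rw [rk3_le, h2]
    rcases h1.lt_or_eq with q | q
    · exact Or.inl q
    · right
      refine ⟨q, ?_⟩
      simp only [dt]
      rw [rc _ _ hwr]
      split_ifs with g1 g2
      · left; omega
      · right; exact ⟨rfl, g2.le⟩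
      · left; omega

/-- Line plus minimality of starting points gives the closing condition. -/
theorem Line.clo {cc : W → ℕ} {s : W → W} {k l : W → ℕ} (H : Line σ cc s k)
    (hc : ∀ u v, cc u = cc v ↔ σ.SameCycle u v) (hm : ∀ v, l (s v) ≤ l v) (v : W) :
    k (σ v) = k v + 1 ∨ (σ v = s v ∧ k (σ v) ≤ k v ∧ ∀ w, k (σ v) ≤ k w → k w ≤ k v →
      cc w = cc v ∧ l (σ v) ≤ l w ∧ k (σ v) ≤ k (σ w) ∧ k (σ w) ≤ k v) := by
  rcases H.suc v with q | q
  · exact Or.inl q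
  · right
    refine ⟨q, q ▸ H.fst v, fun w h1 h2 => ?_⟩
    have hcw : cc w = cc v := by
      rcases lt_trichotomy (cc w) (cc v) with g | g | g
      · have := H.lt w (s v) (by rw [H.mem]; exact g)
        rw [← q] at this; omega
      · exact g
      · have := H.lt _ _ g; omega
    have hcw' : cc (σ w) = cc v := by
      rw [← hcw, hc, Equiv.Perm.sameCycle_apply_left]
    refine ⟨hcw, ?_, ?_, H.lst v q _ hcw'⟩
    · rw [q, ← H.cst _ _ hcw]; exact hm w
    · rw [q, ← H.cst _ _ hcw']; exact H.fst _

theorem full_exists [Fintype W] (σ τ : Equiv.Perm W) :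
    ∃ (x y : W → ℕ) (h : W → ℕ) (Sp : W → Prop),
      Full σ τ (fun w => (x w : ℝ)) (fun w => (y w : ℝ)) h Sp ∧
      (∀ v, x v ≤ Fintype.card W) ∧ (∀ v, y v ≤ Fintype.card W) := by
  obtain ⟨cc, dd, h, r, K⟩ := cyc_exists σ τ
  obtain ⟨R0, R1, R2, R3⟩ := class_argmin cc dd
  have rr : ∀ v, r (r v) = r v := fun v => K.rc _ _ (K.rh v)
  let R : W → W := fun v => if cc v = cc (r v) then r v else R0 v
  have hR1 : ∀ v, cc (R v) = cc v := by
    intro v; simp only [R]; split_ifs with q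
    · exact q.symm
    · exact R1 v
  have hR2 : ∀ v w, cc w = cc v → dd (R v) ≤ dd w := by
    intro v w hw; simp only [R]; split_ifs with q
    · rw [← K.rc w v (K.hcc _ _ hw)]; exact K.d0 w
    · exact R2 v w hw
  have hR3 : ∀ u v, cc u = cc v → R u = R v := by
    intro u v huv; simp only [R]; rw [huv, K.rc u v (K.hcc _ _ huv), R3 u v huv]
  obtain ⟨s, g, x, y, L1, L2, hs, hg, bx, bY, hroot⟩ := starts_spec cc dd K.hc K.hd R hR1 hR2 hR3
  have hr : ∀ v, s (r v) = r v ∧ g (r v) = r v := by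
    intro v
    have e : R (r v) = r v := by simp [R, rr]
    have := hroot (r v) (by
      intro w hw
      rw [e] at hw
      rw [← K.rc w v ((K.hdd _ _ hw).trans (K.rh v))]
      exact K.c0 w)
    rwa [e] at this
  have cx := L1.clo K.hc hs
  have cy := L2.clo K.hd hg
  have ccσ : ∀ v, cc (σ v) = cc v := fun v => (K.hc _ _).2 (by rw [Equiv.Perm.sameCycle_apply_left])
  have ddτ : ∀ v, dd (τ v) = dd v := fun v => (K.hd _ _).2 (by rw [Equiv.Perm.sameCycle_apply_left])
  have hσ : ∀ v, h (σ v) = h v := fun v => K.hcc _ _ (ccσ v)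
  have hτ : ∀ v, h (τ v) = h v := fun v => K.hdd _ _ (ddτ v)
  have xmin : ∀ v w, h w = h v → x (r v) ≤ x w := by
    intro v w hw
    rw [← K.rc w v hw]
    rcases (K.c0 w).lt_or_eq with q | q
    · exact (L1.lt _ _ q).le
    · have := L1.fst w
      rwa [← L1.cst _ _ q, (hr w).1] at this
  have ymin : ∀ v w, h w = h v → y (r v) ≤ y w := by
    intro v w hw
    rw [← K.rc w v hw]
    rcases (K.d0 w).lt_or_eq with q | q
    · exact (L2.lt _ _ q).le
    · have := L2.fst w
      rwa [← L2.cst _ _ q, (hr w).2] at this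
  let Sp : W → Prop := fun l => σ l = r l ∧ ∀ w, h w = h l → ¬ Good σ τ w
  refine ⟨x, y, h, Sp, ⟨⟨?_, ?_, ?_, ?_⟩, hσ, hτ, ?_, ?_, ?_⟩, bx, bY⟩
  · intro u v huv
    have : x u ≠ x v := fun q => huv (L1.inj _ _ q)
    rcases lt_or_gt_of_ne this with q | q
    · left; exact_mod_cast q
    · right; exact_mod_cast q
  · intro u v huv
    have : y u ≠ y v := fun q => huv (L2.inj _ _ q)
    rcases lt_or_gt_of_ne this with q | q
    · left; exact_mod_cast q
    · right; exact_mod_cast q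
  · intro v
    rcases cx v with q | ⟨_, q1, q2⟩
    · left; exact_mod_cast q
    · right
      refine ⟨by exact_mod_cast q1, fun w h1 h2 => ?_⟩
      have := q2 w (by exact_mod_cast h1) (by exact_mod_cast h2)
      exact ⟨by exact_mod_cast this.2.1, by exact_mod_cast this.2.2.1, by exact_mod_cast this.2.2.2⟩
  · intro v
    rcases cy v with q | ⟨_, q1, q2⟩
    · left; exact_mod_cast q
    · right
      refine ⟨by exact_mod_cast q1, fun w h1 h2 => ?_⟩
      have := q2 w (by exact_mod_cast h1) (by exact_mod_cast h2)
      exact ⟨by exact_mod_cast this.2.1, by exact_mod_cast this.2.2.1, by exact_mod_cast this.2.2.2⟩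
  · intro u v huv
    obtain ⟨h1, h2⟩ := K.hlt u v huv
    exact ⟨by exact_mod_cast L1.lt _ _ h1, by exact_mod_cast L2.lt _ _ h2⟩
  · intro u a hua hx hy hsp
    have hx' : x (σ u) ≤ x u := by exact_mod_cast hx
    have hy' : y (τ a) ≤ y a := by exact_mod_cast hy
    rcases cx u with q | ⟨su, -, -⟩
    · omega
    rcases cy a with q | ⟨ga, -, -⟩
    · omega
    have st : s (σ u) = σ u := by rw [L1.cst _ _ (ccσ u), ← su]
    have gt : g (σ u) = σ u := by rw [hua, L2.cst _ _ (ddτ a), ← ga]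
    have hcr : cc (σ u) = cc (r (σ u)) := by
      by_contra hne
      obtain ⟨w, w', e1, e2, e3⟩ := K.step _ hne
      have d1 : dd (σ u) ≤ dd w := by
        by_contra hlt
        have f1 := L2.lt _ _ (not_le.1 hlt)
        have f2 := hs w
        rw [L1.cst _ _ e1, st] at f2
        omega
      obtain ⟨u', f1, f2⟩ := K.mono _ _ d1 w' e2
      have f3 := L1.lt u' (σ u) (lt_of_le_of_lt f2 e3)
      have f4 := hg u'
      rw [L2.cst _ _ f1, gt] at f4
      omega
    have hur : σ u = r u := by
      rw [← st, L1.cst _ _ hcr, (hr _).1, K.rc _ _ (hσ u)]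
    rcases K.good u with hgood | hbad
    · rcases hgood with q | q
      · left
        rw [← hur, hua, Equiv.symm_apply_apply, ← hua] at q
        have : cc a = cc u := by rw [← ccσ u]; exact ((K.hc _ _).2 q).symm
        exact_mod_cast L1.lst u su a this
      · right
        rw [← hur, Equiv.symm_apply_apply, hua] at q
        have : dd u = dd a := by rw [← ddτ a]; exact ((K.hd _ _).2 q).symm
        exact_mod_cast L2.lst a ga u this
    · exact absurd ⟨hur, hbad⟩ hsp
  · rintro l ⟨hl, hbad⟩
    have hbσ : ∀ w, h w = h l → dd (σ w) ≠ dd w := by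
      intro w hw q
      refine hbad (σ w) ((hσ w).trans hw) (Or.inr ?_)
      rw [Equiv.symm_apply_apply]
      exact (K.hd _ _).1 q
    have hbτ : ∀ w, h w = h l → cc (τ w) ≠ cc w := by
      intro w hw q
      refine hbad (τ w) ((hτ w).trans hw) (Or.inl ?_)
      rw [Equiv.symm_apply_apply]
      exact (K.hc _ _).1 q
    have hsl : σ.symm (r l) = l := by rw [← hl, Equiv.symm_apply_apply]
    have hcl : cc l = cc (r l) := by rw [← hl, ccσ]
    have htie : ∀ w, cc w = cc l → dd w ≤ dd l := by
      intro w hw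
      have := K.tie l w (by rw [hsl, ← hl]; exact (hbσ l rfl).symm) (hw.trans hcl)
      rwa [hsl] at this
    have hdlt : dd (r l) < dd l := lt_of_le_of_ne (K.d0 l) (by rw [← hl]; exact hbσ l rfl)
    have hxr := xmin l
    have hyr := ymin l
    refine ⟨?_, ?_, ?_, ?_, ?_, ?_⟩
    · intro w hw
      rw [hl]
      exact ⟨by exact_mod_cast hxr w hw, by exact_mod_cast hyr w hw⟩
    · rw [hl]
      have : x (r l) ≠ x l := by
        intro q
        have := L1.inj _ _ q
        rw [this] at hdlt
        exact lt_irrefl _ hdlt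
      have := hxr l rfl
      have h3 : x (r l) < x l := by omega
      exact_mod_cast h3
    · intro m hm
      rw [hl] at hm ⊢
      have hhm : h m = h l := by rw [← hτ m, hm, K.rh]
      have h1 : y (r l) < y m := by
        have e1 := hyr m hhm
        have e2 : y (r l) ≠ y m := by
          intro q
          have e3 := L2.inj _ _ q
          have e4 := hbτ m hhm
          rw [hm, e3] at e4
          exact e4 rfl
        omega
      have hdm : dd m = dd (r l) := by rw [← ddτ m, hm]
      have h2 : y m < y l := L2.lt _ _ (by omega)
      have h3 : y m < y (σ (r l)) := by
        apply L2.lt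
        have e1 := K.d0 (σ (r l))
        rw [K.rc (σ (r l)) l (by rw [hσ, K.rh])] at e1
        have e2 := hbσ (r l) (K.rh l)
        omega
      exact ⟨by exact_mod_cast h1, by exact_mod_cast h2, by exact_mod_cast h3⟩
    · have : x l < x (τ l) := by
        apply L1.lt
        have e1 := K.c0 (τ l)
        rw [K.rc (τ l) l (hτ l)] at e1
        have e2 := hbτ l rfl
        omega
      exact_mod_cast this
    · rw [hl]
      have e1 := htie (σ (r l)) (by rw [ccσ, hcl])
      have : y (σ (r l)) ≤ y l := by
        rcases e1.lt_or_eq with q | q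
        · exact (L2.lt _ _ q).le
        · have hgs : g l = σ (r l) := by
            have f1 := hg (σ (r l))
            rw [L2.cst _ _ q] at f1
            have hgl : h (g l) = h l := K.hdd _ _ (L2.mem l)
            have f2 := hxr (g l) hgl
            have f3 : x (r l) ≠ x (g l) := by
              intro z
              have z2 := L1.inj _ _ z
              have z3 := L2.mem l
              rw [← z2] at z3
              omega
            rcases L1.suc (r l) with z | z
            · exact L1.inj _ _ (by omega)
            · rw [(hr l).1] at z
              have := hbσ (r l) (K.rh l)
              rw [z] at this
              exact absurd rfl this
          rw [← hgs]
          exact L2.fst l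
      exact_mod_cast this
    · intro u h1 h2
      have h1' : y (τ u) ≤ y l := by exact_mod_cast h1
      have h2' : y l ≤ y u := by exact_mod_cast h2
      rcases cy u with q | ⟨q0, q1, q2⟩
      · omega
      have e1 := (q2 l h1' h2').1
      have hgl : τ u = g l := by rw [q0, L2.cst _ _ e1]
      rw [hgl]
      have hcg : cc (g l) = cc l := by
        have f1 := hg l
        have f2 := K.c0 (g l)
        rw [K.rc _ _ (K.hdd _ _ (L2.mem l)), ← hcl] at f2
        by_contra hne
        have := L1.lt l (g l) (by omega)
        omega
      have f1 := htie (σ (g l)) (by rw [ccσ, hcg])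
      have f2 := hbσ (g l) (K.hdd _ _ (L2.mem l))
      rw [L2.mem] at f2
      have := L2.lt (σ (g l)) (g l) (by rw [L2.mem]; omega)
      exact_mod_cast this

/-- There is an absolute constant `c` such that every graph with
maximum degree 4 on `n` vertices admits a 1-bend RAC drawing with all vertex and bend
points on integer grid points inside a square of side `c * n` (i.e. of `O(n²)` area). -/
theorem stmt1 :
    ∃ c : ℝ, 0 < c ∧
      ∀ (V : Type) [Fintype V] (G : SimpleGraph V),
        (∀ v : V, vdeg G v ≤ 4) →
        ∃ (p : V → Pt) (poly : Sym2 V → List Pt),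
          IsBendRACDrawing 1 G p poly ∧
          InGridSquare (c * (Fintype.card V : ℝ)) (drawingPoints G p poly) := by
  refine ⟨10, by norm_num, ?_⟩
  intro V _ G hG
  obtain ⟨σ, τ, hστ⟩ := graph_perms V G hG
  obtain ⟨x, y, h, Sp, F, bx, bY⟩ := full_exists σ τ
  have hcard : Fintype.card (V × Bool) = 2 * Fintype.card V := by
    rw [Fintype.card_prod, Fintype.card_bool, mul_comm]
  refine assemble G F (fun w => ⟨x w, by simp⟩) (fun w => ⟨y w, by simp⟩) (fun w => ⟨by positivity, ?_⟩)
    (fun w => ⟨by positivity, ?_⟩) (fun v => (v, true)) (fun a b hab => by simpa using hab) hστ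
  · have := bx w
    rw [hcard] at this
    exact_mod_cast this
  · have := bY w
    rw [hcard] at this
    exact_mod_cast this
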